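/- For every rank-r hypergraph G = (V, E, v) with n = |V| vertices (each hyperedge S ∈ E satisfies 2 ≤ |S| ≤ r, with weight v_S ≥ 0) and every ε ∈ (0,1), there exists a hypergraph H = (V, E', v') with E' ⊆ E, |E'| ≤ C · n ε^{-2} log n · log r for an absolute constant C, and nonnegative weights v', such that (1+ε)^{-1} f_H(x) ≤ f_G(x) ≤ (1+ε) f_H(x) for all x ∈ ℝ^V. -/

import Mathlib

open Finset Matrix Real MeasureTheory
open scoped Classical

/-- The energy contribution of a single hyperedge: `max_{i,j ∈ S} (x_i - x_j)²`. -/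
noncomputable def edgeEnergy {n : ℕ} (S : Finset (Fin n)) (x : Fin n → ℝ) : ℝ :=
  if h : (S ×ˢ S).Nonempty then (S ×ˢ S).sup' h (fun q => (x q.1 - x q.2) ^ 2) else 0

set_option linter.unusedSectionVars false

section Gauss

variable {V : Type*} [NormedAddCommGroup V] [InnerProductSpace ℝ V] [FiniteDimensional ℝ V]
  [MeasurableSpace V] [BorelSpace V]

/-- The density of the standard Gaussian measure on a Euclidean space. -/
noncomputable def gaussDensity (z : V) : ℝ :=
  exp (-(1 / 2) * ‖z‖ ^ 2) / (π / (1 / 2)) ^ (Module.finrank ℝ V / 2 : ℝ)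

variable (V) in
/-- The standard Gaussian measure on a Euclidean space. -/
noncomputable def gauss : Measure V :=
  volume.withDensity fun z => ENNReal.ofReal (gaussDensity z)

lemma continuous_gaussDensity : Continuous (gaussDensity : V → ℝ) := by
  unfold gaussDensity
  fun_prop

lemma gaussDensity_nonneg (z : V) : 0 ≤ gaussDensity z := by
  unfold gaussDensity
  positivity

lemma measurable_gaussDensity :
    Measurable fun z : V => ENNReal.ofReal (gaussDensity z) :=
  continuous_gaussDensity.measurable.ennreal_ofReal

lemma lintegral_gauss {f : V → ENNReal} (hf : Measurable f) :
    ∫⁻ z, f z ∂(gauss V) = ∫⁻ z, f z * ENNReal.ofReal (gaussDensity z) := by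
  rw [gauss, lintegral_withDensity_eq_lintegral_mul _ measurable_gaussDensity hf]
  simp [mul_comm]

instance : IsProbabilityMeasure (gauss V) := by
  constructor
  have h := GaussianFourier.integral_rexp_neg_mul_sq_norm (V := V) (b := 1 / 2) (by norm_num)
  have hpos : 0 < (π / (1 / 2)) ^ (Module.finrank ℝ V / 2 : ℝ) := by positivity
  have hInt : Integrable (fun v : V => exp (-(1 / 2) * ‖v‖ ^ 2)) := by
    by_contra hc
    rw [integral_undef hc] at h
    exact hpos.ne h
  have h1 : ∫ z : V, gaussDensity z = 1 := by
    unfold gaussDensity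
    rw [integral_div, h, div_self hpos.ne']
  rw [← lintegral_one, lintegral_gauss measurable_const]
  simp only [one_mul]
  have hInt' : Integrable (gaussDensity : V → ℝ) := hInt.div_const _
  rw [← ofReal_integral_eq_lintegral_ofReal hInt' (Filter.Eventually.of_forall gaussDensity_nonneg),
    h1, ENNReal.ofReal_one]

lemma gaussDensity_add (a z : V) :
    gaussDensity (z - a) = exp (-(‖a‖ ^ 2 / 2)) * (exp (inner ℝ a z) * gaussDensity z) := by
  unfold gaussDensity
  rw [mul_div_assoc', mul_div_assoc', ← exp_add, ← exp_add, @norm_sub_sq ℝ, real_inner_comm]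
  congr 2
  simp only [RCLike.re_to_real]
  rw [real_inner_comm]
  ring

/-- The Cameron–Martin formula. -/
lemma lintegral_gauss_add {f : V → ENNReal} (hf : Measurable f) (a : V) :
    ∫⁻ z, f (z + a) ∂(gauss V) =
      ENNReal.ofReal (exp (-(‖a‖ ^ 2 / 2))) *
        ∫⁻ z, f z * ENNReal.ofReal (exp (inner ℝ a z)) ∂(gauss V) := by
  have hm : Measurable fun z : V => ENNReal.ofReal (exp (inner ℝ a z)) :=
    (by fun_prop : Continuous fun z : V => exp (inner ℝ a z)).measurable.ennreal_ofReal
  rw [lintegral_gauss (f := fun z => f (z + a)) (hf.comp (measurable_add_const a)),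
    lintegral_gauss (f := fun z => f z * ENNReal.ofReal (exp (inner ℝ a z))) (hf.mul hm),
    ← lintegral_const_mul (f := fun z => f z * ENNReal.ofReal (exp (inner ℝ a z)) *
      ENNReal.ofReal (gaussDensity z)) _ ((hf.mul hm).mul measurable_gaussDensity),
    ← lintegral_add_right_eq_self (μ := volume)
      (fun z => ENNReal.ofReal (exp (-(‖a‖ ^ 2 / 2))) *
        (f z * ENNReal.ofReal (exp (inner ℝ a z)) * ENNReal.ofReal (gaussDensity z))) a]
  refine lintegral_congr fun z => ?_
  have h := gaussDensity_add a (z + a)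
  rw [add_sub_cancel_right] at h
  rw [h, ENNReal.ofReal_mul (exp_pos _).le, ENNReal.ofReal_mul (exp_pos _).le]
  ring

lemma lintegral_gauss_neg {f : V → ENNReal} (hf : Measurable f) :
    ∫⁻ z, f (-z) ∂(gauss V) = ∫⁻ z, f z ∂(gauss V) := by
  rw [lintegral_gauss (f := fun z => f (-z)) (hf.comp measurable_neg), lintegral_gauss hf,
    ← lintegral_neg_eq_self (μ := volume)]
  simp [gaussDensity]

lemma lintegral_gauss_exp_inner (a : V) :
    ∫⁻ z, ENNReal.ofReal (exp (inner ℝ a z)) ∂(gauss V) =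
      ENNReal.ofReal (exp (‖a‖ ^ 2 / 2)) := by
  have h := lintegral_gauss_add (V := V) (f := fun _ => 1) measurable_const a
  simp only [lintegral_const, measure_univ, one_mul, mul_one] at h
  calc _ = ENNReal.ofReal (exp (‖a‖ ^ 2 / 2)) * (ENNReal.ofReal (exp (-(‖a‖ ^ 2 / 2))) *
        ∫⁻ z, ENNReal.ofReal (exp (inner ℝ a z)) ∂(gauss V)) := by
        rw [← mul_assoc, ← ENNReal.ofReal_mul (exp_pos _).le, ← exp_add]
        simp
    _ = _ := by rw [← h, mul_one]

/-- Translating a symmetric set decreases its Gaussian measure in a controlled way. -/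
lemma gauss_shift {K : Set V} (hK : MeasurableSet K) (hs : ∀ z ∈ K, -z ∈ K) (c : V) :
    ENNReal.ofReal (exp (-(‖c‖ ^ 2 / 2))) * gauss V K ≤ gauss V {z | z - c ∈ K} := by
  have hf : Measurable (K.indicator (1 : V → ENNReal)) := measurable_one.indicator hK
  have hm : ∀ c : V, Measurable fun z : V => ENNReal.ofReal (exp (inner ℝ c z)) := fun c =>
    (by fun_prop : Continuous fun z : V => exp (inner ℝ c z)).measurable.ennreal_ofReal
  have hsym : ∀ z, K.indicator (1 : V → ENNReal) (-z) = K.indicator 1 z := by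
    intro z
    by_cases h : z ∈ K
    · simp [h, hs z h]
    · have : -z ∉ K := fun h' => h (by simpa using hs _ h')
      simp [h, this]
  have h1 : gauss V {z | z - c ∈ K} =
      ∫⁻ z, K.indicator (1 : V → ENNReal) (z + (-c)) ∂(gauss V) := by
    have hset : MeasurableSet {z | z - c ∈ K} := hK.preimage (measurable_sub_const c)
    rw [← lintegral_indicator_one hset]
    refine lintegral_congr fun z => ?_
    simp only [Set.indicator, Set.mem_ofPred_eq, sub_eq_add_neg, Pi.one_apply]
  rw [h1, lintegral_gauss_add hf]
  simp only [norm_neg]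
  gcongr
  set I := ∫⁻ z, K.indicator (1 : V → ENNReal) z * ENNReal.ofReal (exp (inner ℝ (-c) z)) ∂(gauss V)
    with hI
  have h2 : I = ∫⁻ z, K.indicator (1 : V → ENNReal) z *
      ENNReal.ofReal (exp (inner ℝ c z)) ∂(gauss V) := by
    rw [hI, ← lintegral_gauss_neg (f := fun z => K.indicator (1 : V → ENNReal) z *
      ENNReal.ofReal (exp (inner ℝ (-c) z))) (hf.mul (hm _))]
    refine lintegral_congr fun z => ?_
    simp only [hsym, inner_neg_neg]
  have h3 : 2 * gauss V K ≤ I + I := by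
    nth_rewrite 2 [h2]
    rw [hI, ← lintegral_add_left (f := fun z => K.indicator (1 : V → ENNReal) z *
      ENNReal.ofReal (exp (inner ℝ (-c) z))) (hf.mul (hm _)), ← lintegral_indicator_one hK,
      ← lintegral_const_mul _ hf]
    refine lintegral_mono fun z => ?_
    simp only [inner_neg_left]
    rw [← mul_add, mul_comm, ← ENNReal.ofReal_add (exp_pos _).le (exp_pos _).le]
    gcongr
    have : (2 : ℝ) ≤ exp (-inner ℝ c z) + exp (inner ℝ c z) := by
      have := one_le_cosh (inner ℝ c z)
      rw [cosh_eq] at this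
      linarith
    simpa using ENNReal.ofReal_le_ofReal this
  rw [← two_mul] at h3
  exact (ENNReal.mul_le_mul_iff_right (by norm_num) (by norm_num)).1 h3

end Gauss

section GaussMoments

variable {V : Type*} [NormedAddCommGroup V] [InnerProductSpace ℝ V] [FiniteDimensional ℝ V]
  [MeasurableSpace V] [BorelSpace V]

lemma lintegral_gauss_exp_norm_sq :
    ∫⁻ z : V, ENNReal.ofReal (exp (‖z‖ ^ 2 / 4)) ∂(gauss V) =
      ENNReal.ofReal (2 ^ (Module.finrank ℝ V / 2 : ℝ)) := by
  have h := GaussianFourier.integral_rexp_neg_mul_sq_norm (V := V) (b := 1 / 4) (by norm_num)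
  have hpos : 0 < (π / (1 / 4)) ^ (Module.finrank ℝ V / 2 : ℝ) := by positivity
  have hInt : Integrable (fun v : V => exp (-(1 / 4) * ‖v‖ ^ 2)) := by
    by_contra hc
    rw [integral_undef hc] at h
    exact hpos.ne h
  have hm : Measurable fun z : V => ENNReal.ofReal (exp (‖z‖ ^ 2 / 4)) :=
    (by fun_prop : Continuous fun z : V => exp (‖z‖ ^ 2 / 4)).measurable.ennreal_ofReal
  set c : ℝ := (π / (1 / 2)) ^ (Module.finrank ℝ V / 2 : ℝ) with hc
  have hcpos : 0 < c := by positivity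
  have hd : ∀ z : V, ENNReal.ofReal (exp (‖z‖ ^ 2 / 4)) * ENNReal.ofReal (gaussDensity z) =
      ENNReal.ofReal (exp (-(1 / 4) * ‖z‖ ^ 2) / c) := by
    intro z
    rw [← ENNReal.ofReal_mul (exp_pos _).le, gaussDensity, mul_div_assoc', ← exp_add]
    congr 3
    ring
  rw [lintegral_gauss hm]
  simp only [hd]
  have hInt' : Integrable fun z : V => exp (-(1 / 4) * ‖z‖ ^ 2) / c := hInt.div_const _
  rw [← ofReal_integral_eq_lintegral_ofReal hInt'
    (Filter.Eventually.of_forall fun z => by positivity), integral_div, h, hc,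
    ← div_rpow (by positivity) (by positivity)]
  congr 2
  field_simp
  norm_num

lemma lintegral_gauss_norm_sq :
    ∫⁻ z : V, ENNReal.ofReal (‖z‖ ^ 2) ∂(gauss V) ≤
      ENNReal.ofReal (2 * Module.finrank ℝ V + 4) := by
  set K : ℝ := 2 ^ (Module.finrank ℝ V / 2 : ℝ) with hK
  have hKpos : 0 < K := by positivity
  have hlog : log K = (Module.finrank ℝ V / 2 : ℝ) * log 2 := by
    rw [hK, log_rpow (by norm_num)]
  have hlog0 : 0 ≤ log K := by rw [hlog]; positivity
  have hm : Measurable fun z : V => ENNReal.ofReal (exp (‖z‖ ^ 2 / 4)) :=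
    (by fun_prop : Continuous fun z : V => exp (‖z‖ ^ 2 / 4)).measurable.ennreal_ofReal
  have hpt : ∀ z : V, ENNReal.ofReal (‖z‖ ^ 2) ≤
      ENNReal.ofReal (4 * log K) + ENNReal.ofReal (4 / K) * ENNReal.ofReal (exp (‖z‖ ^ 2 / 4)) := by
    intro z
    rw [← ENNReal.ofReal_mul (by positivity), ← ENNReal.ofReal_add (by positivity) (by positivity)]
    apply ENNReal.ofReal_le_ofReal
    have h := add_one_le_exp (‖z‖ ^ 2 / 4 - log K)
    rw [exp_sub, exp_log hKpos] at h
    have : 4 / K * exp (‖z‖ ^ 2 / 4) = 4 * (exp (‖z‖ ^ 2 / 4) / K) := by ring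
    rw [this]
    linarith
  calc _ ≤ ∫⁻ z : V, (ENNReal.ofReal (4 * log K) +
        ENNReal.ofReal (4 / K) * ENNReal.ofReal (exp (‖z‖ ^ 2 / 4))) ∂(gauss V) :=
        lintegral_mono hpt
    _ = ENNReal.ofReal (4 * log K + 4 / K * K) := by
        rw [lintegral_add_left measurable_const, lintegral_const_mul _ hm,
          lintegral_gauss_exp_norm_sq, ← ENNReal.ofReal_mul (by positivity), lintegral_const,
          measure_univ, mul_one, ← ENNReal.ofReal_add (by positivity) (by positivity)]
    _ ≤ _ := by
        apply ENNReal.ofReal_le_ofReal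
        rw [div_mul_cancel₀ _ hKpos.ne', hlog]
        have := log_two_lt_d9
        have hn : (0 : ℝ) ≤ Module.finrank ℝ V := by positivity
        nlinarith

lemma sq_le_add_exp {t A l : ℝ} (ht : 0 ≤ t) (hl : 0 < l) :
    t ^ 2 ≤ 2 * A ^ 2 + 4 / l ^ 2 * exp (l * (t - A)) := by
  have hA : t ^ 2 ≤ 2 * A ^ 2 + 2 * (t - A) ^ 2 := by nlinarith [sq_nonneg (t - 2 * A)]
  have he : 0 ≤ 4 / l ^ 2 * exp (l * (t - A)) := by positivity
  by_cases h : t ≤ A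
  · nlinarith
  push Not at h
  have hu : 0 ≤ l * (t - A) := mul_nonneg hl.le (by linarith)
  have h2 := quadratic_le_exp_of_nonneg hu
  have h3 : 2 * (t - A) ^ 2 ≤ 4 / l ^ 2 * exp (l * (t - A)) := by
    rw [div_mul_eq_mul_div, le_div_iff₀ (by positivity)]
    nlinarith
  linarith

/-- The second moment of the maximum of finitely many Gaussian variables. -/
lemma lintegral_gauss_max_le {P : Type*} (s : Finset P) (a : P → V) {δ : ℝ} (hδ : 0 < δ)
    {N : ℝ} (hN : 2 ≤ N) (hs : (s.card : ℝ) ≤ N) (ha : ∀ p ∈ s, ‖a p‖ ^ 2 ≤ δ) (M : V → ℝ)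
    (hM : ∀ z, M z ≤ 0 ∨ ∃ p ∈ s, M z ≤ (inner ℝ (a p) z) ^ 2) :
    ∫⁻ z, ENNReal.ofReal (M z) ∂(gauss V) ≤ ENNReal.ofReal (30 * δ * log N) := by
  have hNpos : 0 < N := by linarith
  have hlogN : 0.69 ≤ log N := by
    have := log_two_gt_d9
    have := log_le_log (by norm_num) hN
    linarith
  set l := √(log N) with hl
  have hl2 : l ^ 2 = log N := sq_sqrt (by linarith)
  have hlpos : 0 < l := sqrt_pos.2 (by linarith)
  set A := 3 * l / 2 with hA
  set c := δ * (4 / l ^ 2 * exp (-(l * A))) with hc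
  have hcpos : 0 < c := by positivity
  set b : P → V := fun p => (l / √δ) • a p with hb
  have hsδ : 0 < √δ := sqrt_pos.2 hδ
  have hm : ∀ c : V, Measurable fun z : V => ENNReal.ofReal (exp (inner ℝ c z)) := fun c =>
    (by fun_prop : Continuous fun z : V => exp (inner ℝ c z)).measurable.ennreal_ofReal
  have hbn : ∀ p ∈ s, ‖b p‖ ^ 2 ≤ l ^ 2 := by
    intro p hp
    rw [hb, norm_smul, mul_pow, norm_eq_abs, sq_abs, div_pow, sq_sqrt hδ.le, div_mul_eq_mul_div,
      div_le_iff₀ hδ]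
    exact mul_le_mul_of_nonneg_left (ha p hp) (sq_nonneg _)
  have hpt : ∀ z, ENNReal.ofReal (M z) ≤ ENNReal.ofReal (δ * (2 * A ^ 2)) +
      ∑ p ∈ s, ENNReal.ofReal c * (ENNReal.ofReal (exp (inner ℝ (b p) z)) +
        ENNReal.ofReal (exp (inner ℝ (-b p) z))) := by
    intro z
    rcases hM z with h | ⟨p, hp, h⟩
    · rw [ENNReal.ofReal_of_nonpos h]; exact bot_le
    refine le_trans ?_ (add_le_add le_rfl (Finset.single_le_sum
      (f := fun p => ENNReal.ofReal c * (ENNReal.ofReal (exp (inner ℝ (b p) z)) +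
        ENNReal.ofReal (exp (inner ℝ (-b p) z)))) (fun _ _ => bot_le) hp))
    rw [← ENNReal.ofReal_add (exp_pos _).le (exp_pos _).le, ← ENNReal.ofReal_mul hcpos.le,
      ← ENNReal.ofReal_add (by positivity) (by positivity)]
    apply ENNReal.ofReal_le_ofReal
    refine h.trans ?_
    set t := |inner ℝ (a p) z| / √δ with ht
    have h1 : (inner ℝ (a p) z) ^ 2 = δ * t ^ 2 := by
      rw [ht, div_pow, sq_abs, sq_sqrt hδ.le]; field_simp
    have h2 := sq_le_add_exp (t := t) (A := A) (by positivity) hlpos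
    have h3 : exp (l * t) ≤ exp (inner ℝ (b p) z) + exp (inner ℝ (-b p) z) := by
      have e1 : inner ℝ (b p) z = l / √δ * inner ℝ (a p) z := by
        rw [hb, real_inner_smul_left]
      rw [inner_neg_left, e1, ht]
      rcases abs_cases (inner ℝ (a p) z) with ⟨h, _⟩ | ⟨h, _⟩
      · rw [h]
        have : l * (inner ℝ (a p) z / √δ) = l / √δ * inner ℝ (a p) z := by ring
        rw [this]
        linarith [exp_pos (-(l / √δ * inner ℝ (a p) z))]
      · rw [h]
        have : l * (-inner ℝ (a p) z / √δ) = -(l / √δ * inner ℝ (a p) z) := by ring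
        rw [this]
        linarith [exp_pos (l / √δ * inner ℝ (a p) z)]
    rw [h1]
    calc δ * t ^ 2 ≤ δ * (2 * A ^ 2 + 4 / l ^ 2 * exp (l * (t - A))) := by gcongr
      _ = δ * (2 * A ^ 2) + c * exp (l * t) := by
          rw [hc, mul_sub, sub_eq_add_neg, exp_add]; ring
      _ ≤ _ := by gcongr
  have hb1 : ∀ p ∈ s, ∫⁻ z, ENNReal.ofReal (exp (inner ℝ (b p) z)) +
      ENNReal.ofReal (exp (inner ℝ (-b p) z)) ∂(gauss V) ≤
        ENNReal.ofReal (2 * exp (l ^ 2 / 2)) := by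
    intro p hp
    rw [lintegral_add_left (hm _), lintegral_gauss_exp_inner, lintegral_gauss_exp_inner, norm_neg,
      ← ENNReal.ofReal_add (exp_pos _).le (exp_pos _).le, ← two_mul]
    apply ENNReal.ofReal_le_ofReal
    gcongr
    exact (abs_le_of_sq_le_sq' (hbn p hp) hlpos.le).2
  calc _ ≤ ∫⁻ z, (ENNReal.ofReal (δ * (2 * A ^ 2)) +
      ∑ p ∈ s, ENNReal.ofReal c * (ENNReal.ofReal (exp (inner ℝ (b p) z)) +
        ENNReal.ofReal (exp (inner ℝ (-b p) z)))) ∂(gauss V) := lintegral_mono hpt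
    _ = ENNReal.ofReal (δ * (2 * A ^ 2)) + ∑ p ∈ s, ENNReal.ofReal c *
        ∫⁻ z, (ENNReal.ofReal (exp (inner ℝ (b p) z)) +
        ENNReal.ofReal (exp (inner ℝ (-b p) z))) ∂(gauss V) := by
        rw [lintegral_add_left measurable_const, lintegral_const, measure_univ, mul_one,
          lintegral_finsetSum]
        · congr 1
          refine Finset.sum_congr rfl fun p _ => ?_
          exact lintegral_const_mul _ ((hm _).add (hm _))
        · intro p _
          exact ((hm _).add (hm _)).const_mul _
    _ ≤ ENNReal.ofReal (δ * (2 * A ^ 2)) + ∑ p ∈ s, ENNReal.ofReal c *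
        ENNReal.ofReal (2 * exp (l ^ 2 / 2)) := by
        gcongr with p hp
        exact hb1 p hp
    _ = ENNReal.ofReal (δ * (2 * A ^ 2) + s.card * (c * (2 * exp (l ^ 2 / 2)))) := by
        rw [Finset.sum_const, nsmul_eq_mul, ENNReal.ofReal_add (by positivity) (by positivity),
          ENNReal.ofReal_mul (p := (s.card : ℝ)) (by positivity), ENNReal.ofReal_natCast,
          ENNReal.ofReal_mul hcpos.le]
    _ ≤ _ := by
        apply ENNReal.ofReal_le_ofReal
        have e1 : c * (2 * exp (l ^ 2 / 2)) = δ * (8 / l ^ 2) / N := by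
          have : exp (-(l * A)) * exp (l ^ 2 / 2) = N⁻¹ := by
            rw [← exp_add, hA]
            have : -(l * (3 * l / 2)) + l ^ 2 / 2 = -log N := by rw [← hl2]; ring
            rw [this, Real.exp_neg, exp_log hNpos]
          calc c * (2 * exp (l ^ 2 / 2)) =
              δ * (8 / l ^ 2) * (exp (-(l * A)) * exp (l ^ 2 / 2)) := by rw [hc]; ring
            _ = _ := by rw [this]; ring
        rw [e1]
        have h1 : (s.card : ℝ) * (δ * (8 / l ^ 2) / N) ≤ N * (δ * (8 / l ^ 2) / N) := by gcongr
        have h2 : N * (δ * (8 / l ^ 2) / N) = δ * (8 / l ^ 2) := by field_simp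
        have h3 : 8 / l ^ 2 ≤ 18 * l ^ 2 := by
          rw [div_le_iff₀ (by positivity), hl2]
          nlinarith
        have h4 : 2 * A ^ 2 = 9 / 2 * l ^ 2 := by rw [hA]; ring
        rw [h4, ← hl2]
        have h5 : δ * (8 / l ^ 2) ≤ δ * (18 * l ^ 2) := by gcongr
        have : 0 ≤ δ * l ^ 2 := by positivity
        linarith

end GaussMoments

section Cells

variable {V : Type} [NormedAddCommGroup V] [InnerProductSpace ℝ V] [FiniteDimensional ℝ V]
  [MeasurableSpace V] [BorelSpace V]

/-- The scale of the `i`-th level of the chain. -/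
noncomputable def scale (i : ℕ) : ℝ := (1 / 4) ^ i

lemma scale_pos (i : ℕ) : 0 < scale i := by unfold scale; positivity

lemma scale_succ (i : ℕ) : scale (i + 1) = scale i / 4 := by unfold scale; rw [pow_succ]; ring

lemma scale_zero : scale 0 = 1 := by simp [scale]

lemma scale_succ_le (i : ℕ) : scale (i + 1) ≤ scale i := by
  rw [scale_succ]; linarith [scale_pos i]

variable (V) in
/-- A family of seminorms, one for each level and each point, whose balls serve as the cells of a
chaining argument for the set `T`. -/
structure CellSystem where
  D : ℕ → V → Seminorm ℝ V
  D₀ : Seminorm ℝ V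
  T : Set V
  R : ℝ
  cont : ∀ i x, Continuous (D i x)
  mono : ∀ i x z, D i x z ≤ D (i + 1) x z
  base_le : ∀ i x z, D₀ z ≤ D i x z
  comp : ∀ i x x', D₀ (x - x') ≤ scale (i + 1) → ∀ z, D i x z ≤ D (i + 1) x' z
  good : ∀ i, ∀ x ∈ T, ENNReal.ofReal (1 / 4) ≤ gauss V {z | D i x z ≤ 1}
  norm_le : ∀ i x z, ‖z‖ ≤ R * D i x z
  R_nonneg : 0 ≤ R
  T_le : ∀ x ∈ T, ‖x‖ ≤ 1

lemma exists_min_norm_point {B : Set V} (hne : B.Nonempty) (hcl : IsClosed B) (hcv : Convex ℝ B) :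
    ∃ y ∈ B, ∀ w ∈ B, ‖w - y‖ ^ 2 + ‖y‖ ^ 2 ≤ ‖w‖ ^ 2 := by
  obtain ⟨y, hy, h⟩ := exists_norm_eq_iInf_of_complete_convex hne hcl.isComplete hcv 0
  rw [norm_eq_iInf_iff_real_inner_le_zero hcv hy] at h
  refine ⟨y, hy, fun w hw => ?_⟩
  have h1 := h w hw
  rw [zero_sub, inner_neg_left] at h1
  have h2 := norm_add_sq_real (w - y) y
  rw [sub_add_cancel, real_inner_comm] at h2
  linarith

/-- If separated subsets have bounded size, there is a finite net. -/
lemma exists_finite_net {α : Type*} (A : Set α) (r : α → α → Prop) (hsymm : ∀ x y, r x y → r y x)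
    (hrefl : ∀ x, r x x) (M : ℝ)
    (hM : ∀ N : Finset α, ↑N ⊆ A → (∀ x ∈ N, ∀ y ∈ N, x ≠ y → ¬ r x y) → (N.card : ℝ) ≤ M) :
    ∃ N : Finset α, ↑N ⊆ A ∧ (N.card : ℝ) ≤ M ∧ ∀ x ∈ A, ∃ q ∈ N, r x q := by
  by_contra! hcon
  have key : ∀ k : ℕ, ∃ N : Finset α, ↑N ⊆ A ∧ (∀ x ∈ N, ∀ y ∈ N, x ≠ y → ¬ r x y) ∧
      N.card = k := by
    intro k
    induction k with
    | zero => exact ⟨∅, by simp, by simp, rfl⟩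
    | succ k ih =>
      obtain ⟨N, hN, hs, hc⟩ := ih
      obtain ⟨x, hx, hq⟩ := hcon N hN (hM N hN hs)
      have hxN : x ∉ N := fun h => hq x h (hrefl x)
      refine ⟨insert x N, ?_, ?_, by rw [card_insert_of_notMem hxN, hc]⟩
      · simp only [coe_insert, Set.insert_subset_iff]
        exact ⟨hx, hN⟩
      · intro a ha b hb hab
        rw [mem_insert] at ha hb
        rcases ha with rfl | ha <;> rcases hb with rfl | hb
        · exact absurd rfl hab
        · exact hq b hb
        · exact fun h => hq a ha (hsymm _ _ h)
        · exact hs a ha b hb hab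
  obtain ⟨N, hN, hs, hc⟩ := key (⌈M⌉₊ + 1)
  have := hM N hN hs
  rw [hc] at this
  push_cast at this
  linarith [Nat.le_ceil M]

namespace CellSystem

variable (S : CellSystem V)

/-- The cell of `x` at level `i`. -/
def ball (i : ℕ) (x : V) : Set V := {y | S.D i x (y - x) ≤ scale i}

/-- Two points lie in each other's cell at level `i`. -/
def Near (i : ℕ) (x y : V) : Prop := S.D i x (x - y) ≤ scale i ∧ S.D i y (x - y) ≤ scale i

lemma near_symm {i : ℕ} {x y : V} (h : S.Near i x y) : S.Near i y x := by
  unfold Near at *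
  rw [map_sub_rev (S.D i y), map_sub_rev (S.D i x)]
  exact h.symm

lemma near_refl (i : ℕ) (x : V) : S.Near i x x := by
  simp [Near, (scale_pos i).le]

lemma mem_ball_self (i : ℕ) (x : V) : x ∈ S.ball i x := by
  simp [ball, (scale_pos i).le]

lemma exists_center (i : ℕ) (x : V) :
    ∃ y ∈ S.ball i x, ∀ w ∈ S.ball i x, ‖w - y‖ ^ 2 + ‖y‖ ^ 2 ≤ ‖w‖ ^ 2 := by
  apply exists_min_norm_point ⟨x, S.mem_ball_self i x⟩
  · exact isClosed_le ((S.cont i x).comp (continuous_sub_right x)) continuous_const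
  · intro a ha b hb s t hs ht hst
    change S.D i x (s • a + t • b - x) ≤ scale i
    have : s • a + t • b - x = s • (a - x) + t • (b - x) := by
      have : x = (s + t) • x := by rw [hst, one_smul]
      conv_lhs => rw [this]
      simp only [smul_sub, add_smul]
      abel
    rw [this]
    refine (map_add_le_add _ _ _).trans ?_
    rw [map_smul_eq_mul, map_smul_eq_mul, norm_of_nonneg hs, norm_of_nonneg ht]
    have ha' : S.D i x (a - x) ≤ scale i := ha
    have hb' : S.D i x (b - x) ≤ scale i := hb
    calc _ ≤ s * scale i + t * scale i := by gcongr
      _ = _ := by rw [← add_mul, hst, one_mul]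

/-- The point of minimal norm of a cell. -/
noncomputable def center (i : ℕ) (x : V) : V := (S.exists_center i x).choose

lemma center_mem (i : ℕ) (x : V) : S.center i x ∈ S.ball i x :=
  (S.exists_center i x).choose_spec.1

lemma center_spec {i : ℕ} {x w : V} (hw : w ∈ S.ball i x) :
    ‖w - S.center i x‖ ^ 2 + ‖S.center i x‖ ^ 2 ≤ ‖w‖ ^ 2 :=
  (S.exists_center i x).choose_spec.2 w hw

/-- The squared distance of a cell to the origin. -/
noncomputable def height (i : ℕ) (x : V) : ℝ := ‖S.center i x‖ ^ 2

lemma height_nonneg (i : ℕ) (x : V) : 0 ≤ S.height i x := sq_nonneg _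

lemma height_le_of_mem {i : ℕ} {x w : V} (hw : w ∈ S.ball i x) : S.height i x ≤ ‖w‖ ^ 2 := by
  have := S.center_spec hw
  unfold height
  nlinarith [sq_nonneg ‖w - S.center i x‖]

lemma height_le_one (i : ℕ) {x : V} (hx : x ∈ S.T) : S.height i x ≤ 1 := by
  have := S.height_le_of_mem (S.mem_ball_self i x)
  have h1 := S.T_le x hx
  nlinarith [norm_nonneg x]

lemma height_le_height {i j : ℕ} {x x' : V} (h : S.ball i x ⊆ S.ball j x') :
    S.height j x' ≤ S.height i x :=
  S.height_le_of_mem (h (S.center_mem i x))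

lemma ball_succ_subset (i : ℕ) (x : V) : S.ball (i + 1) x ⊆ S.ball i x := fun y hy =>
  (S.mono i x _).trans ((show S.D (i + 1) x (y - x) ≤ scale (i + 1) from hy).trans
    (scale_succ_le i))

lemma height_mono (x : V) : Monotone fun i => S.height i x :=
  monotone_nat_of_le_succ fun i => S.height_le_height (S.ball_succ_subset i x)

lemma ball_subset_of_mem {i : ℕ} {x x' : V} (h : S.D (i + 1) x (x' - x) ≤ scale (i + 1)) :
    S.ball (i + 1) x ⊆ S.ball i x' := by
  intro w hw
  have hw' : S.D (i + 1) x (w - x) ≤ scale (i + 1) := hw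
  have h0 : S.D₀ (x' - x) ≤ scale (i + 1) := (S.base_le _ _ _).trans h
  change S.D i x' (w - x') ≤ scale i
  refine (S.comp i x' x h0 _).trans ?_
  have : w - x' = (w - x) - (x' - x) := by abel
  rw [this]
  have h1 := map_sub_le_add (S.D (i + 1) x) (w - x) (x' - x)
  have := scale_succ i
  linarith [scale_pos i]

lemma card_le_of_separated (i : ℕ) (N : Finset V) (hT : ↑N ⊆ S.T)
    (hsep : ∀ x ∈ N, ∀ y ∈ N, x ≠ y → ¬ S.Near i x y) (c : V) (β : ℝ)
    (hβ : ∀ x ∈ N, ‖S.center (i + 2) x - c‖ ^ 2 ≤ β) :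
    (N.card : ℝ) ≤ 4 * exp (β / (2 * scale (i + 2) ^ 2)) := by
  set s := scale (i + 2) with hs
  have hspos : 0 < s := scale_pos _
  have h4s : 4 * s = scale (i + 1) := by rw [hs, scale_succ (i + 1)]; ring
  have h16s : 16 * s = scale i := by
    have := scale_succ i; linarith
  set u : V → V := fun x => s⁻¹ • (S.center (i + 2) x - c) with hu
  set U : V → Set V := fun x => {z | z - u x ∈ {z | S.D (i + 2) x z ≤ 1}} with hU
  have hKm : ∀ x, MeasurableSet {z | S.D (i + 2) x z ≤ 1} := fun x =>
    (isClosed_le (S.cont _ x) continuous_const).measurableSet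
  have hUm : ∀ x, MeasurableSet (U x) := fun x => (hKm x).preimage (measurable_sub_const (u x))
  have hlow : ∀ x ∈ N, ENNReal.ofReal (exp (-(β / (2 * s ^ 2))) * (1 / 4)) ≤ gauss V (U x) := by
    intro x hx
    refine le_trans ?_ (gauss_shift (hKm x) (fun z hz => by simpa using hz) (u x))
    rw [ENNReal.ofReal_mul (exp_pos _).le]
    refine mul_le_mul' (ENNReal.ofReal_le_ofReal ?_) (S.good _ x (hT hx))
    rw [exp_le_exp, neg_le_neg_iff, hu, norm_smul, mul_pow, norm_inv, norm_of_nonneg hspos.le]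
    calc (s⁻¹) ^ 2 * ‖S.center (i + 2) x - c‖ ^ 2 / 2 ≤ (s⁻¹) ^ 2 * β / 2 := by
          gcongr; exact hβ x hx
      _ = _ := by field_simp
  have hball : ∀ x w, w ∈ U x → S.D (i + 2) x (s • w + c - x) ≤ 2 * s := by
    intro x w hw
    have h1 : S.D (i + 2) x (w - u x) ≤ 1 := hw
    have h2 : S.D (i + 2) x (S.center (i + 2) x - x) ≤ s := S.center_mem (i + 2) x
    have e : s • w + c - x = s • (w - u x) + (S.center (i + 2) x - x) := by
      rw [hu, smul_sub, smul_smul, mul_inv_cancel₀ hspos.ne', one_smul]; abel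
    rw [e]
    refine (map_add_le_add _ _ _).trans ?_
    rw [map_smul_eq_mul, norm_of_nonneg hspos.le]
    nlinarith
  have hdisj : ∀ x ∈ N, ∀ y ∈ N, x ≠ y → Disjoint (U x) (U y) := by
    intro x hx y hy hxy
    rw [Set.disjoint_left]
    intro w hwx hwy
    apply hsep x hx y hy hxy
    have h1 := hball x w hwx
    have h2 := hball y w hwy
    have e : x - y = (s • w + c - y) - (s • w + c - x) := by abel
    have h0 : S.D₀ (x - y) ≤ scale (i + 1) := by
      rw [e]
      refine (map_sub_le_add _ _ _).trans ?_
      linarith [S.base_le (i + 2) x (s • w + c - x), S.base_le (i + 2) y (s • w + c - y)]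
    have h0' : S.D₀ (y - x) ≤ scale (i + 1) := by rwa [map_sub_rev]
    constructor
    · rw [e]
      refine (map_sub_le_add _ _ _).trans ?_
      linarith [S.comp i x y h0 (s • w + c - y), S.mono (i + 1) y (s • w + c - y),
        S.mono i x (s • w + c - x), S.mono (i + 1) x (s • w + c - x)]
    · rw [e]
      refine (map_sub_le_add _ _ _).trans ?_
      linarith [S.comp i y x h0' (s • w + c - x), S.mono (i + 1) x (s • w + c - x),
        S.mono i y (s • w + c - y), S.mono (i + 1) y (s • w + c - y)]
  have hsum : ∑ x ∈ N, gauss V (U x) ≤ 1 := by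
    rw [← measure_biUnion_finset (fun x hx y hy hxy => hdisj x hx y hy hxy) (fun x _ => hUm x)]
    exact prob_le_one
  have h2 : ENNReal.ofReal (N.card * (exp (-(β / (2 * s ^ 2))) * (1 / 4))) ≤ 1 := by
    refine le_trans ?_ hsum
    rw [ENNReal.ofReal_mul (by positivity), ENNReal.ofReal_natCast, ← nsmul_eq_mul]
    exact Finset.card_nsmul_le_sum _ _ _ hlow
  rw [ENNReal.ofReal_le_one, Real.exp_neg] at h2
  have hpos := exp_pos (β / (2 * s ^ 2))
  have e3 : (N.card : ℝ) * ((exp (β / (2 * s ^ 2)))⁻¹ * (1 / 4)) =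
      N.card / (4 * exp (β / (2 * s ^ 2))) := by field_simp
  rw [e3, div_le_one (by positivity)] at h2
  exact h2

/-- The increment of the height over five levels, truncated at the size of the cell. -/
noncomputable def incr (i : ℕ) (x : V) : ℝ :=
  min (S.height (i + 5) x - S.height i x) (S.R ^ 2 * scale i ^ 2)

lemma incr_nonneg (i : ℕ) (x : V) : 0 ≤ S.incr i x :=
  le_min (sub_nonneg.2 (S.height_mono x (by omega))) (by positivity)

lemma center_dist_le {i : ℕ} {x q : V} (h : S.Near (i + 2) x q) :
    ‖S.center (i + 5) x - S.center (i + 1) q‖ ^ 2 ≤ S.incr i x := by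
  have hxq : S.D (i + 2) x (q - x) ≤ scale (i + 2) := by rw [map_sub_rev]; exact h.1
  have hqx : S.D (i + 1) q (x - q) ≤ scale (i + 1) :=
    (S.mono _ _ _).trans (h.2.trans (scale_succ_le _))
  have hsub : S.ball (i + 5) x ⊆ S.ball (i + 1) q :=
    (S.ball_succ_subset (i + 4) x).trans <| (S.ball_succ_subset (i + 3) x).trans <|
      (S.ball_succ_subset (i + 2) x).trans (S.ball_subset_of_mem hxq)
  have hmem := hsub (S.center_mem (i + 5) x)
  apply le_min
  · have h1 := S.center_spec hmem
    have h2 := S.height_le_height (S.ball_subset_of_mem hqx)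
    unfold height at *
    linarith
  · have h1 : S.D (i + 1) q (S.center (i + 5) x - q) ≤ scale (i + 1) := hmem
    have h2 : S.D (i + 1) q (S.center (i + 1) q - q) ≤ scale (i + 1) := S.center_mem (i + 1) q
    have e : S.center (i + 5) x - S.center (i + 1) q =
      (S.center (i + 5) x - q) - (S.center (i + 1) q - q) := by abel
    have h3 := map_sub_le_add (S.D (i + 1) q) (S.center (i + 5) x - q) (S.center (i + 1) q - q)
    rw [← e] at h3
    have h4 := S.norm_le (i + 1) q (S.center (i + 5) x - S.center (i + 1) q)
    rw [← mul_pow]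
    refine pow_le_pow_left₀ (norm_nonneg _) (h4.trans ?_) 2
    refine mul_le_mul_of_nonneg_left ?_ S.R_nonneg
    have := scale_succ i
    linarith [scale_pos i]

/-- The logarithmic size of the nets of the chain. -/
noncomputable def cost (i : ℕ) (x : V) : ℝ :=
  4 ^ 10 * (1 + ∑ j ∈ range i, (S.incr j x / scale j ^ 2 + 1))

end CellSystem

end Cells

section Chain

variable {V : Type} [NormedAddCommGroup V] [InnerProductSpace ℝ V] [FiniteDimensional ℝ V]
  [MeasurableSpace V] [BorelSpace V]

lemma sum_geometric_weights_le (M : ℕ) :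
    ∑ m : Fin (M + 1), 4 * exp (m : ℕ) * (exp (-2 * (m : ℕ)) / 8) ≤ 1 := by
  have h1 : ∀ m : Fin (M + 1), 4 * exp (m : ℕ) * (exp (-2 * (m : ℕ)) / 8) ≤
      (1 / 2) * (1 / 2) ^ (m : ℕ) := by
    intro m
    have e : exp ((m : ℕ) : ℝ) * exp (-2 * (m : ℕ)) = (exp (-1)) ^ (m : ℕ) := by
      rw [← exp_add, ← exp_nat_mul]; congr 1; ring
    have h2 : exp (-1) ≤ 1 / 2 := by
      rw [Real.exp_neg, inv_le_comm₀ (exp_pos _) (by norm_num)]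
      have := add_one_le_exp (1 : ℝ)
      norm_num at this ⊢
      linarith
    calc _ = 1 / 2 * (exp ((m : ℕ) : ℝ) * exp (-2 * (m : ℕ))) := by ring
      _ ≤ _ := by
        rw [e]
        have := pow_le_pow_left₀ (exp_pos _).le h2 (m : ℕ)
        linarith
  refine (Finset.sum_le_sum fun m _ => h1 m).trans ?_
  rw [← Finset.mul_sum, Fin.sum_univ_eq_sum_range (fun m => (1 / 2 : ℝ) ^ m)]
  have h3 : ∑ m ∈ range (M + 1), (1 / 2 : ℝ) ^ m ≤ 2 := by
    have := geom_sum_eq (by norm_num : (1 / 2 : ℝ) ≠ 1) (M + 1)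
    rw [this]
    have hp : (0 : ℝ) < (1 / 2) ^ (M + 1) := by positivity
    rw [div_le_iff_of_neg (by norm_num)]
    linarith
  linarith

namespace CellSystem

variable (S : CellSystem V)

lemma cost_succ (i : ℕ) (x : V) :
    S.cost (i + 1) x = S.cost i x + 4 ^ 10 * (S.incr i x / scale i ^ 2 + 1) := by
  unfold cost
  rw [Finset.sum_range_succ]
  ring

/-- Weighted nets at all levels, whose logarithmic weights are controlled by the heights. -/
theorem exists_weighted_net (i : ℕ) :
    ∃ (Q : Type) (_ : Fintype Q) (pt : Q → V) (p : Q → ℝ), (∀ q, 0 < p q) ∧ ∑ q, p q ≤ 1 ∧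
      (∀ q, pt q ∈ S.T) ∧
      ∀ x ∈ S.T, ∃ q, S.Near (i + 2) x (pt q) ∧ log (1 / p q) ≤ S.cost i x := by
  induction i with
  | zero =>
    obtain ⟨N, hNT, hcard, hnet⟩ := exists_finite_net S.T (S.Near 2) (fun _ _ => S.near_symm)
      (S.near_refl 2) (4 * exp (1 / (2 * scale 4 ^ 2))) (fun N hN hsep =>
        S.card_le_of_separated 2 N hN hsep 0 1 fun x hx => by
          rw [sub_zero]; exact S.height_le_one 4 (hN hx))
    set K := 4 * exp (1 / (2 * scale 4 ^ 2)) with hK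
    have hKpos : 0 < K := by positivity
    refine ⟨N, inferInstance, fun q => q.1, fun _ => 1 / K, fun _ => by positivity, ?_,
      fun q => hNT q.2, fun x hx => ?_⟩
    · rw [Finset.sum_const, nsmul_eq_mul, Finset.card_univ, Fintype.card_coe]
      rw [mul_one_div, div_le_one hKpos]
      exact hcard
    · obtain ⟨q, hq, hxq⟩ := hnet x hx
      refine ⟨⟨q, hq⟩, hxq, ?_⟩
      rw [one_div_one_div, hK, log_mul (by norm_num) (exp_pos _).ne', log_exp]
      have h4 : log 4 ≤ 3 := by
        have := log_le_sub_one_of_pos (show (0 : ℝ) < 4 by norm_num)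
        linarith
      simp only [cost, range_zero, sum_empty, add_zero]
      unfold scale
      norm_num
      linarith
  | succ i ih =>
    obtain ⟨Q, hQ, pt, p, hp, hp1, hT, hnet⟩ := ih
    set σ := scale (i + 5) ^ 2 with hσ
    have hσpos : 0 < σ := pow_pos (scale_pos _) 2
    set M := ⌈1 / (2 * σ)⌉₊ with hM
    have hN : ∀ (q : Q) (m : ℕ), ∃ N : Finset V,
        ↑N ⊆ {x | x ∈ S.T ∧ S.Near (i + 2) x (pt q) ∧
          ‖S.center (i + 5) x - S.center (i + 1) (pt q)‖ ^ 2 ≤ 2 * m * σ} ∧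
        (N.card : ℝ) ≤ 4 * exp m ∧
        ∀ x ∈ {x | x ∈ S.T ∧ S.Near (i + 2) x (pt q) ∧
          ‖S.center (i + 5) x - S.center (i + 1) (pt q)‖ ^ 2 ≤ 2 * m * σ},
          ∃ y ∈ N, S.Near (i + 3) x y := by
      intro q m
      refine exists_finite_net _ (S.Near (i + 3)) (fun _ _ => S.near_symm) (S.near_refl _) _
        fun N hN hsep => ?_
      have := S.card_le_of_separated (i + 3) N (fun x hx => (hN hx).1) hsep
        (S.center (i + 1) (pt q)) (2 * m * σ) (fun x hx => (hN hx).2.2)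
      refine this.trans (le_of_eq ?_)
      congr 2
      change 2 * m * σ / (2 * σ) = m
      field_simp
    choose N hNsub hNcard hNnet using hN
    refine ⟨Σ q : Q, Σ m : Fin (M + 1), N q m, inferInstance, fun t => t.2.2.1,
      fun t => p t.1 * (exp (-2 * (t.2.1 : ℕ)) / 8), fun t => mul_pos (hp _) (by positivity), ?_,
      fun t => (hNsub _ _ t.2.2.2).1, fun x hx => ?_⟩
    · rw [Fintype.sum_sigma]
      refine le_trans (Finset.sum_le_sum fun q _ => ?_) hp1
      rw [Fintype.sum_sigma]
      simp only [Finset.sum_const, nsmul_eq_mul, Finset.card_univ, Fintype.card_coe]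
      calc ∑ m : Fin (M + 1), ((N q m).card : ℝ) * (p q * (exp (-2 * (m : ℕ)) / 8)) ≤
          ∑ m : Fin (M + 1), p q * (4 * exp (m : ℕ) * (exp (-2 * (m : ℕ)) / 8)) := by
            refine Finset.sum_le_sum fun m _ => ?_
            have h1 := hNcard q m
            have h2 : 0 < p q * (exp (-2 * (m : ℕ)) / 8) := mul_pos (hp q) (by positivity)
            calc _ ≤ 4 * exp (m : ℕ) * (p q * (exp (-2 * (m : ℕ)) / 8)) :=
                  mul_le_mul_of_nonneg_right h1 h2.le
              _ = _ := by ring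
        _ ≤ p q := by
            rw [← Finset.mul_sum]
            have := sum_geometric_weights_le M
            have := mul_le_mul_of_nonneg_left this (hp q).le
            linarith
    · obtain ⟨q, hxq, hlog⟩ := hnet x hx
      set β := ‖S.center (i + 5) x - S.center (i + 1) (pt q)‖ ^ 2 with hβ
      have hβi : β ≤ S.incr i x := S.center_dist_le hxq
      have hβ0 : 0 ≤ β := sq_nonneg _
      have hβ1 : β ≤ 1 := by
        have h1 : S.incr i x ≤ _ := min_le_left _ _
        have := S.height_nonneg i x
        have := S.height_le_one (i + 5) hx
        linarith
      set m := ⌈β / (2 * σ)⌉₊ with hm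
      have hmM : m < M + 1 := Nat.lt_succ_of_le (Nat.ceil_mono (by gcongr))
      have hm1 : β / (2 * σ) ≤ m := Nat.le_ceil _
      have hm2 : (m : ℝ) < β / (2 * σ) + 1 := Nat.ceil_lt_add_one (by positivity)
      obtain ⟨y, hy, hxy⟩ := hNnet q m x ⟨hx, hxq, by
        rw [div_le_iff₀ (by positivity)] at hm1
        linarith⟩
      refine ⟨⟨q, ⟨m, hmM⟩, ⟨y, hy⟩⟩, hxy, ?_⟩
      have hpq := hp q
      rw [cost_succ]
      simp only
      rw [one_div, log_inv, log_mul hpq.ne' (by positivity), log_div (exp_pos _).ne' (by norm_num),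
        log_exp]
      rw [one_div, log_inv] at hlog
      have h8 : log 8 ≤ 7 := by
        have := log_le_sub_one_of_pos (show (0 : ℝ) < 8 by norm_num)
        linarith
      have hsc : σ = scale i ^ 2 / 4 ^ 10 := by
        rw [hσ]; unfold scale; rw [pow_add]; ring
      have hsi := scale_pos i
      have h5 : β / (2 * σ) * 2 ≤ 4 ^ 10 * (S.incr i x / scale i ^ 2) := by
        rw [hsc]
        have : β / (2 * (scale i ^ 2 / 4 ^ 10)) * 2 = 4 ^ 10 * (β / scale i ^ 2) := by field_simp
        rw [this]
        gcongr
      linarith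

end CellSystem

end Chain

section Signs

/-- The real number `1` or `-1` attached to a boolean. -/
noncomputable def boolSign (b : Bool) : ℝ := if b then 1 else -1

lemma boolSign_cases (b : Bool) : boolSign b = 1 ∨ boolSign b = -1 := by
  cases b <;> simp [boolSign]

variable {ι : Type*} [Fintype ι]

lemma sum_signs_exp_le (c : ι → ℝ) :
    ∑ e : ι → Bool, exp (∑ k, boolSign (e k) * c k) ≤
      Fintype.card (ι → Bool) * exp ((∑ k, c k ^ 2) / 2) := by
  have h1 : ∑ e : ι → Bool, exp (∑ k, boolSign (e k) * c k) =
      ∏ k, ∑ b : Bool, exp (boolSign b * c k) := by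
    rw [Finset.prod_univ_sum, Fintype.piFinset_univ]
    simp only [exp_sum]
  rw [h1]
  have h2 : ∀ k, ∑ b : Bool, exp (boolSign b * c k) ≤ 2 * exp (c k ^ 2 / 2) := by
    intro k
    have := cosh_le_exp_half_sq (c k)
    rw [cosh_eq] at this
    simp [boolSign]
    linarith
  refine (Finset.prod_le_prod (fun k _ => by positivity) (fun k _ => h2 k)).trans ?_
  rw [Finset.prod_mul_distrib, ← exp_sum, Finset.sum_div]
  simp

lemma sum_signs_cosh_le (c : ι → ℝ) (l : ℝ) :
    ∑ e : ι → Bool, cosh (l * ∑ k, boolSign (e k) * c k) ≤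
      Fintype.card (ι → Bool) * exp (l ^ 2 * (∑ k, c k ^ 2) / 2) := by
  have h1 := sum_signs_exp_le fun k => l * c k
  have h2 := sum_signs_exp_le fun k => -l * c k
  have e1 : ∀ (l : ℝ) (e : ι → Bool), ∑ k, boolSign (e k) * (l * c k) =
      l * ∑ k, boolSign (e k) * c k := by
    intro l e
    rw [Finset.mul_sum]
    exact Finset.sum_congr rfl fun k _ => by ring
  have e2 : ∀ l : ℝ, ∑ k, (l * c k) ^ 2 = l ^ 2 * ∑ k, c k ^ 2 := by
    intro l
    rw [Finset.mul_sum]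
    exact Finset.sum_congr rfl fun k _ => by ring
  simp only [e1, e2] at h1 h2
  simp only [cosh_eq, ← Finset.sum_div, Finset.sum_add_distrib]
  simp only [neg_mul, neg_sq] at h2
  linarith

/-- A union bound over a weighted family of signed sums. -/
theorem exists_signs {Ω : Type*} [Fintype Ω] (p : Ω → ℝ) (hp : ∀ a, 0 < p a)
    (hsum : ∑ a, p a ≤ 1) (c : Ω → ι → ℝ) :
    ∃ e : ι → Bool, ∀ a, |∑ k, boolSign (e k) * c a k| ≤
      √(∑ k, c a k ^ 2) * √(2 * log (2 / p a)) := by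
  have hp1 : ∀ a, p a ≤ 1 := fun a =>
    (Finset.single_le_sum (fun b _ => (hp b).le) (Finset.mem_univ a)).trans hsum
  set L : Ω → ℝ := fun a => log (2 / p a) with hL
  have hLpos : ∀ a, 0 < L a := fun a => log_pos (by
    rw [lt_div_iff₀ (hp a)]; linarith [hp1 a])
  have hexpL : ∀ a, exp (L a) = 2 / p a := fun a => exp_log (div_pos two_pos (hp a))
  set l : Ω → ℝ := fun a => √(2 * L a) / √(∑ k, c a k ^ 2) with hl
  set F : (ι → Bool) → ℝ := fun e =>
    ∑ a, p a * (p a / 2 * cosh (l a * ∑ k, boolSign (e k) * c a k)) with hF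
  have hls : ∀ a, l a ^ 2 * (∑ k, c a k ^ 2) / 2 ≤ L a := by
    intro a
    have h0 : 0 ≤ ∑ k, c a k ^ 2 := Finset.sum_nonneg fun k _ => sq_nonneg _
    rw [hl, div_pow, sq_sqrt (by linarith [hLpos a]), sq_sqrt h0]
    rcases h0.eq_or_lt with h | h
    · rw [← h]; simp [(hLpos a).le]
    · rw [div_mul_cancel₀ _ h.ne']; linarith
  have htotal : ∑ e : ι → Bool, F e ≤ ∑ e : ι → Bool, (1 : ℝ) := by
    rw [hF, Finset.sum_comm]
    simp only [← Finset.mul_sum]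
    rw [Finset.sum_const, nsmul_eq_mul, mul_one, Finset.card_univ]
    calc _ ≤ ∑ a, p a * (Fintype.card (ι → Bool) : ℝ) := by
          refine Finset.sum_le_sum fun a _ => mul_le_mul_of_nonneg_left ?_ (hp a).le
          have h1 := sum_signs_cosh_le (c a) (l a)
          have h2 : exp (l a ^ 2 * (∑ k, c a k ^ 2) / 2) ≤ 2 / p a := by
            rw [← hexpL]; exact exp_le_exp.2 (hls a)
          have hpa := hp a
          calc _ ≤ p a / 2 * (Fintype.card (ι → Bool) * (2 / p a)) := by
                gcongr
                exact h1.trans (by gcongr)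
            _ = _ := by field_simp
      _ ≤ _ := by
          rw [← Finset.sum_mul]
          have : (0 : ℝ) ≤ Fintype.card (ι → Bool) := by positivity
          nlinarith
  obtain ⟨e, -, he⟩ := Finset.exists_le_of_sum_le Finset.univ_nonempty htotal
  refine ⟨e, fun a => ?_⟩
  set U := ∑ k, boolSign (e k) * c a k with hU
  have hpa := hp a
  have h1 : p a * (p a / 2 * cosh (l a * U)) ≤ 1 :=
    (Finset.single_le_sum (f := fun a => p a * (p a / 2 * cosh (l a * ∑ k, boolSign (e k) * c a k)))
      (fun b _ => mul_nonneg (hp b).le (mul_nonneg (by linarith [hp b]) (cosh_pos _).le))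
      (Finset.mem_univ a)).trans he
  have h0 : 0 ≤ ∑ k, c a k ^ 2 := Finset.sum_nonneg fun k _ => sq_nonneg _
  rcases h0.eq_or_lt with h | h
  · have hz : ∀ k, c a k = 0 := fun k => by
      have := (Finset.sum_eq_zero_iff_of_nonneg fun k _ => sq_nonneg (c a k)).1 h.symm k
        (Finset.mem_univ k)
      exact pow_eq_zero_iff two_ne_zero |>.1 this
    rw [hU, ← h]
    simp [hz]
  · have hs : 0 < √(∑ k, c a k ^ 2) := sqrt_pos.2 h
    have h2L : 0 < √(2 * L a) := sqrt_pos.2 (by linarith [hLpos a])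
    have hlpos : 0 < l a := div_pos h2L hs
    have h3 : exp (l a * |U|) ≤ exp (2 * L a) := by
      have : exp (2 * L a) = (2 / p a) ^ 2 := by rw [← hexpL, ← exp_nat_mul]; norm_num
      rw [this]
      have h4 : exp (l a * |U|) ≤ 2 * cosh (l a * U) := by
        rw [← cosh_abs, abs_mul, abs_of_pos hlpos, cosh_eq]
        linarith [exp_pos (-(l a * |U|))]
      refine h4.trans ?_
      rw [div_pow, le_div_iff₀ (by positivity)]
      nlinarith
    have h5 : l a * |U| ≤ 2 * L a := exp_le_exp.1 h3
    rw [mul_comm, ← le_div_iff₀ hlpos] at h5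
    refine h5.trans (le_of_eq ?_)
    have h6 : 2 * L a = √(2 * L a) * √(2 * L a) := (mul_self_sqrt (by linarith [hLpos a])).symm
    rw [hl]
    simp only
    rw [div_div_eq_mul_div, div_eq_iff h2L.ne']
    change 2 * L a * _ = _ * √(2 * L a) * √(2 * L a)
    nth_rewrite 1 [h6]
    ring

end Signs

section CostSums

variable {V : Type} [NormedAddCommGroup V] [InnerProductSpace ℝ V] [FiniteDimensional ℝ V]
  [MeasurableSpace V] [BorelSpace V]

lemma sum_le_of_recurrence (g e : ℕ → ℝ) (hg : ∀ i, 0 ≤ g i) (h0 : g 0 ≤ e 0)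
    (hs : ∀ i, g (i + 1) ≤ g i / 4 + e (i + 1)) (I : ℕ) :
    ∑ i ∈ range I, g i ≤ 4 / 3 * ∑ i ∈ range I, e i := by
  have key : ∀ I, ∑ i ∈ range (I + 1), g i + g I / 3 ≤ 4 / 3 * ∑ i ∈ range (I + 1), e i := by
    intro I
    induction I with
    | zero => simp; linarith
    | succ I ih =>
      rw [Finset.sum_range_succ, Finset.sum_range_succ _ (I + 1)]
      linarith [hs I]
  cases I with
  | zero => simp
  | succ I => linarith [key I, hg I]

lemma sum_scale_le (I : ℕ) : ∑ i ∈ range I, scale i ≤ 4 / 3 := by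
  have := sum_le_of_recurrence scale (fun i => if i = 0 then 1 else 0) (fun i => (scale_pos i).le)
    (by simp [scale_zero]) (fun i => by simp [scale_succ]) I
  refine this.trans ?_
  rw [Finset.sum_ite_eq' (range I) 0]
  split_ifs <;> norm_num

lemma sum_height_sub (h : ℕ → ℝ) (h0 : ∀ i, 0 ≤ h i) (h1 : ∀ i, h i ≤ 1) (I : ℕ) :
    ∑ j ∈ range I, (h (j + 5) - h j) ≤ 5 := by
  have key : ∑ j ∈ range I, (h (j + 5) - h j) =
      (h I + h (I + 1) + h (I + 2) + h (I + 3) + h (I + 4)) - (h 0 + h 1 + h 2 + h 3 + h 4) := by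
    induction I with
    | zero => simp
    | succ I ih => rw [Finset.sum_range_succ, ih]; ring_nf
  rw [key]
  linarith [h0 0, h0 1, h0 2, h0 3, h0 4, h1 I, h1 (I + 1), h1 (I + 2), h1 (I + 3), h1 (I + 4)]

lemma log_two_le_of_two_le {n : ℕ} (hn : 2 ≤ n) : 0.69 ≤ log n := by
  have := log_two_gt_d9
  have h : log 2 ≤ log n := log_le_log (by norm_num) (by exact_mod_cast hn)
  linarith

lemma sqrt_log_ge {n : ℕ} (hn : 2 ≤ n) : 0.8 ≤ √(log n) := by
  apply le_sqrt_of_sq_le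
  have := log_two_le_of_two_le hn
  norm_num at this ⊢
  linarith

namespace CellSystem

variable (S : CellSystem V)

lemma sum_incr_le {x : V} (hx : x ∈ S.T) (I : ℕ) : ∑ i ∈ range I, S.incr i x ≤ 5 :=
  (Finset.sum_le_sum fun _ _ => min_le_left _ _).trans
    (sum_height_sub (fun i => S.height i x) (fun i => S.height_nonneg i x)
      (fun i => S.height_le_one i hx) I)

lemma one_le_cost (i : ℕ) (x : V) : 4 ^ 10 * ((i : ℝ) + 1) ≤ S.cost i x := by
  unfold cost
  refine mul_le_mul_of_nonneg_left ?_ (by norm_num)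
  rw [Finset.sum_add_distrib]
  have : 0 ≤ ∑ j ∈ range i, S.incr j x / scale j ^ 2 :=
    Finset.sum_nonneg fun j _ => div_nonneg (S.incr_nonneg j x) (sq_nonneg _)
  simp
  linarith

lemma cost_nonneg (i : ℕ) (x : V) : 0 ≤ S.cost i x := by
  have := S.one_le_cost i x
  have : (0 : ℝ) ≤ 4 ^ 10 * ((i : ℝ) + 1) := by positivity
  linarith

lemma cost_le_succ (i : ℕ) (x : V) : S.cost i x ≤ S.cost (i + 1) x := by
  rw [cost_succ]
  have := div_nonneg (S.incr_nonneg i x) (sq_nonneg (scale i))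
  linarith

lemma scale_sq_cost_zero (x : V) :
    scale 0 ^ 2 * S.cost 1 x = 4 ^ 10 * (S.incr 0 x + 2 * scale 0 ^ 2) := by
  simp [cost, scale_zero]
  ring

lemma scale_sq_cost_succ (i : ℕ) (x : V) :
    scale (i + 1) ^ 2 * S.cost (i + 2) x = scale i ^ 2 * S.cost (i + 1) x / 16 +
      4 ^ 10 * (S.incr (i + 1) x + scale (i + 1) ^ 2) := by
  rw [cost_succ]
  have := scale_pos (i + 1)
  have e : scale i ^ 2 = 16 * scale (i + 1) ^ 2 := by rw [scale_succ]; ring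
  rw [e]
  field_simp

lemma sum_scale_sq_cost_le {x : V} (hx : x ∈ S.T) (I : ℕ) :
    ∑ i ∈ range I, scale i ^ 2 * S.cost (i + 1) x ≤ 4 ^ 12 := by
  have hn : ∀ i, 0 ≤ scale i ^ 2 * S.cost (i + 1) x := fun i =>
    mul_nonneg (sq_nonneg _) (S.cost_nonneg _ _)
  have h := sum_le_of_recurrence (fun i => scale i ^ 2 * S.cost (i + 1) x)
    (fun i => 4 ^ 10 * (S.incr i x + 2 * scale i ^ 2)) hn
    (S.scale_sq_cost_zero x).le (fun i => by
      rw [S.scale_sq_cost_succ]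
      have := hn i
      have := sq_nonneg (scale (i + 1))
      linarith) I
  refine h.trans ?_
  rw [← Finset.mul_sum, Finset.sum_add_distrib, ← Finset.mul_sum]
  have h1 := S.sum_incr_le hx I
  have h2 : ∑ i ∈ range I, scale i ^ 2 ≤ 4 / 3 := by
    refine le_trans (Finset.sum_le_sum fun i _ => ?_) (sum_scale_le I)
    have : scale i ≤ 1 := by unfold scale; exact pow_le_one₀ (by norm_num) (by norm_num)
    have := scale_pos i
    nlinarith
  nlinarith

lemma sum_sqrt_incr_le {n : ℕ} (hn : 2 ≤ n) (hR : S.R ≤ 8 * √n) {x : V} (hx : x ∈ S.T) (I : ℕ) :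
    ∑ i ∈ range I, √(S.incr i x) ≤ 25 * √(log n) := by
  set L := √(log n) with hL
  have hL8 : 0.8 ≤ L := sqrt_log_ge hn
  have hlog := log_two_le_of_two_le hn
  have hL2 : L ^ 2 = log n := sq_sqrt (by linarith)
  have hLpos : 0 < L := by linarith
  set J := ⌈2 * log n⌉₊ with hJ
  have hn0 : (0 : ℝ) < n := by positivity
  have hpt : ∀ i, √(S.incr i x) ≤ L / 2 * (S.height (i + 5) x - S.height i x) +
      ((if i < J then 1 / (2 * L) else 0) + 8 * (1 / 2) ^ i) := by
    intro i
    have hd : 0 ≤ S.height (i + 5) x - S.height i x := sub_nonneg.2 (S.height_mono x (by omega))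
    have hp : (0 : ℝ) < 8 * (1 / 2) ^ i := by positivity
    have hp' : 0 ≤ L / 2 * (S.height (i + 5) x - S.height i x) := by positivity
    split_ifs with hi
    · have h1 : √(S.incr i x) ≤ √(S.height (i + 5) x - S.height i x) :=
        sqrt_le_sqrt (min_le_left _ _)
      set t := √(S.height (i + 5) x - S.height i x) with ht
      have ht2 : t ^ 2 = S.height (i + 5) x - S.height i x := sq_sqrt hd
      rw [← ht2]
      have h2 : t ≤ L / 2 * t ^ 2 + 1 / (2 * L) := by
        have : L / 2 * t ^ 2 + 1 / (2 * L) - t = (L * t - 1) ^ 2 / (2 * L) := by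
          field_simp; ring
        have : 0 ≤ (L * t - 1) ^ 2 / (2 * L) := by positivity
        linarith
      linarith
    · have h1 : √(S.incr i x) ≤ S.R * scale i := by
        rw [sqrt_le_left (mul_nonneg S.R_nonneg (scale_pos i).le), mul_pow]
        exact min_le_right _ _
      have hpow : (n : ℝ) ≤ 2 ^ i := by
        have h3 : 2 * log n ≤ i := (Nat.le_ceil _).trans (by exact_mod_cast not_lt.1 hi)
        rw [← log_le_log_iff hn0 (by positivity), log_pow]
        have := log_two_gt_d9
        nlinarith
      have hs1 : √(n : ℝ) ≤ 2 ^ i := by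
        refine le_trans ?_ hpow
        rw [sqrt_le_left hn0.le]
        have : (2 : ℝ) ≤ n := by exact_mod_cast hn
        nlinarith
      have h2 : S.R * scale i ≤ 8 * (1 / 2) ^ i := by
        have e : scale i = (1 / 2) ^ i * (1 / 2) ^ i := by
          unfold scale; rw [← mul_pow]; norm_num
        have e2 : (2 : ℝ) ^ i * (1 / 2) ^ i = 1 := by rw [← mul_pow]; norm_num
        have hpi : (0 : ℝ) < (1 / 2) ^ i := by positivity
        calc S.R * scale i ≤ 8 * 2 ^ i * scale i := by
              have := (scale_pos i).le
              gcongr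
              linarith
          _ = 8 * (1 / 2) ^ i * (2 ^ i * (1 / 2) ^ i) := by rw [e]; ring
          _ = _ := by rw [e2, mul_one]
      linarith
  refine (Finset.sum_le_sum fun i _ => hpt i).trans ?_
  rw [Finset.sum_add_distrib, Finset.sum_add_distrib, ← Finset.mul_sum, ← Finset.mul_sum]
  have h1 := sum_height_sub (fun i => S.height i x) (fun i => S.height_nonneg i x)
      (fun i => S.height_le_one i hx) I
  have h2 : ∑ i ∈ range I, (if i < J then 1 / (2 * L) else 0) ≤ 2 * L := by
    rw [← Finset.sum_filter, Finset.sum_const, nsmul_eq_mul]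
    have hc : ((range I).filter (· < J)).card ≤ J := by
      calc _ ≤ (range J).card := Finset.card_le_card fun i hi => by
            simp at hi ⊢; exact hi.2
        _ = J := card_range J
    have hJ' : (J : ℝ) ≤ 4 * log n := by
      have := Nat.ceil_lt_add_one (show 0 ≤ 2 * log (n : ℝ) by linarith)
      linarith
    have hc' : (((range I).filter (· < J)).card : ℝ) ≤ 4 * L ^ 2 := by
      rw [hL2]; exact le_trans (by exact_mod_cast hc) hJ'
    calc _ ≤ 4 * L ^ 2 * (1 / (2 * L)) := by gcongr
      _ = _ := by field_simp; norm_num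
  have h3 : ∑ i ∈ range I, (1 / 2 : ℝ) ^ i ≤ 2 := by
    have := geom_sum_eq (by norm_num : (1 / 2 : ℝ) ≠ 1) I
    rw [this]
    have hp : (0 : ℝ) < (1 / 2) ^ I := by positivity
    rw [div_le_iff_of_neg (by norm_num)]
    linarith
  have h4 := mul_le_mul_of_nonneg_left h1 (show 0 ≤ L / 2 by positivity)
  linarith

lemma sum_scale_sqrt_cost_le {n : ℕ} (hn : 2 ≤ n) (hR : S.R ≤ 8 * √n) {x : V} (hx : x ∈ S.T)
    (I : ℕ) : ∑ i ∈ range I, scale i * √(S.cost (i + 1) x) ≤ 2 ^ 16 * √(log n) := by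
  have hrw : ∀ i, scale i * √(S.cost (i + 1) x) = √(scale i ^ 2 * S.cost (i + 1) x) := by
    intro i
    rw [sqrt_mul (sq_nonneg _), sqrt_sq (scale_pos i).le]
  have h4 : √((4 : ℝ) ^ 10) = 2 ^ 10 := by
    rw [show (4 : ℝ) ^ 10 = (2 ^ 10) ^ 2 by norm_num, sqrt_sq (by norm_num)]
  have hsub : ∀ {a b : ℝ}, 0 ≤ a → √(a + b) ≤ √a + √b := fun {a b} ha => by
    rcases le_total 0 b with hb | hb
    · rw [sqrt_le_left (by positivity), add_sq, sq_sqrt ha, sq_sqrt hb]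
      have : 0 ≤ 2 * √a * √b := by positivity
      linarith
    · rw [sqrt_eq_zero_of_nonpos hb, add_zero]
      exact sqrt_le_sqrt (by linarith)
  have he : ∀ i (c : ℝ), 0 ≤ c → c ≤ 2 → √(4 ^ 10 * (S.incr i x + c * scale i ^ 2)) ≤
      2 ^ 10 * (√(S.incr i x) + 2 * scale i) := by
    intro i c hc hc2
    rw [sqrt_mul (by norm_num), h4]
    gcongr
    refine (hsub (S.incr_nonneg i x)).trans ?_
    gcongr
    have := scale_pos i
    rw [sqrt_le_left (by positivity)]
    nlinarith [sq_nonneg (scale i)]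
  have h := sum_le_of_recurrence (fun i => scale i * √(S.cost (i + 1) x))
    (fun i => 2 ^ 10 * (√(S.incr i x) + 2 * scale i))
    (fun i => mul_nonneg (scale_pos i).le (sqrt_nonneg _))
    (by
      simp only [hrw, zero_add]
      rw [S.scale_sq_cost_zero]
      exact he 0 2 (by norm_num) (by norm_num))
    (fun i => by
      simp only [hrw]
      rw [S.scale_sq_cost_succ]
      have hnn : 0 ≤ scale i ^ 2 * S.cost (i + 1) x / 16 :=
        div_nonneg (mul_nonneg (sq_nonneg _) (S.cost_nonneg _ _)) (by norm_num)
      refine (hsub hnn).trans ?_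
      have e1 : √(scale i ^ 2 * S.cost (i + 1) x / 16) =
          √(scale i ^ 2 * S.cost (i + 1) x) / 4 := by
        rw [sqrt_div' _ (by norm_num), show (16 : ℝ) = 4 ^ 2 by norm_num, sqrt_sq (by norm_num)]
      rw [e1]
      have := he (i + 1) 1 (by norm_num) (by norm_num)
      rw [one_mul] at this
      gcongr) I
  refine h.trans ?_
  rw [← Finset.mul_sum, Finset.sum_add_distrib, ← Finset.mul_sum]
  have h1 := S.sum_sqrt_incr_le hn hR hx I
  have h2 := sum_scale_le I
  have h3 := sqrt_log_ge hn
  linarith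

end CellSystem

end CostSums

section Family

variable {V : Type} [NormedAddCommGroup V] [InnerProductSpace ℝ V] [FiniteDimensional ℝ V]
  [MeasurableSpace V] [BorelSpace V] {ι : Type} [Fintype ι]

/-- A nonnegative multiple of a seminorm. -/
noncomputable def scaledSeminorm (c : ℝ) (hc : 0 ≤ c) (p : Seminorm ℝ V) : Seminorm ℝ V :=
  NNReal.mk c hc • p

lemma scaledSeminorm_apply (c : ℝ) (hc : 0 ≤ c) (p : Seminorm ℝ V) (z : V) :
    scaledSeminorm c hc p z = c * p z := rfl

lemma continuous_seminorm_of_le (p : Seminorm ℝ V) {C : ℝ} (hC : 0 ≤ C)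
    (h : ∀ z, p z ≤ C * ‖z‖) : Continuous p := by
  refine Seminorm.continuous_of_le (q := scaledSeminorm C hC (normSeminorm ℝ V)) ?_ h
  change Continuous fun z : V => C * ‖z‖
  fun_prop

lemma sqrt_sum_add_sq_le (u v : ι → ℝ) :
    √(∑ k, (u k + v k) ^ 2) ≤ √(∑ k, u k ^ 2) + √(∑ k, v k ^ 2) := by
  have h := norm_add_le (WithLp.toLp 2 u : EuclideanSpace ℝ ι) (WithLp.toLp 2 v)
  simpa [EuclideanSpace.norm_eq] using h

/-- The weighted `ℓ²` combination of a finite family of seminorms. -/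
noncomputable def combSeminorm (N : ι → Seminorm ℝ V) (w : ι → ℝ) : Seminorm ℝ V :=
  Seminorm.of (fun z => √(∑ k, (w k * N k z) ^ 2))
    (fun x y => by
      have h := sqrt_sum_add_sq_le (fun k => w k * N k x) (fun k => w k * N k y)
      refine le_trans (sqrt_le_sqrt (Finset.sum_le_sum fun k _ => ?_)) h
      rw [← mul_add, mul_pow, mul_pow]
      gcongr
      exact map_add_le_add _ _ _)
    (fun c x => by
      have : ∀ k, (w k * N k (c • x)) ^ 2 = c ^ 2 * (w k * N k x) ^ 2 := by
        intro k
        rw [map_smul_eq_mul, mul_pow, mul_pow, mul_pow, norm_eq_abs, sq_abs]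
        ring
      simp only [this, ← Finset.mul_sum]
      rw [sqrt_mul (sq_nonneg _), sqrt_sq_eq_abs, norm_eq_abs])

lemma combSeminorm_apply (N : ι → Seminorm ℝ V) (w : ι → ℝ) (z : V) :
    combSeminorm N w z = √(∑ k, (w k * N k z) ^ 2) := rfl

lemma combSeminorm_mono (N : ι → Seminorm ℝ V) {w w' : ι → ℝ} (h0 : ∀ k, 0 ≤ w k)
    (h : ∀ k, w k ≤ w' k) (z : V) : combSeminorm N w z ≤ combSeminorm N w' z := by
  rw [combSeminorm_apply, combSeminorm_apply]
  refine sqrt_le_sqrt (Finset.sum_le_sum fun k _ => ?_)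
  have := apply_nonneg (N k) z
  have := h0 k
  have := h k
  gcongr

variable (V ι) in
/-- A finite family of seminorms with bounds on its Gaussian second moments. -/
structure GaussFamily where
  N : ι → Seminorm ℝ V
  Ninf : Seminorm ℝ V
  a : ℝ
  b : ℝ
  a_pos : 0 < a
  b_pos : 0 < b
  le_inf : ∀ k z, N k z ≤ Ninf z
  inf_le : ∀ z, Ninf z ≤ √b * ‖z‖
  int_le : ∀ k, ∫⁻ z, ENNReal.ofReal (N k z ^ 2) ∂(gauss V) ≤ ENNReal.ofReal a
  int_inf_le : ∫⁻ z, ENNReal.ofReal (Ninf z ^ 2) ∂(gauss V) ≤ ENNReal.ofReal b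
  two_le : 2 ≤ Module.finrank ℝ V

namespace GaussFamily

variable (F : GaussFamily V ι)

lemma continuous_inf : Continuous F.Ninf :=
  continuous_seminorm_of_le _ (sqrt_nonneg _) F.inf_le

lemma continuous_N (k : ι) : Continuous (F.N k) :=
  continuous_seminorm_of_le _ (sqrt_nonneg _) fun z => (F.le_inf k z).trans (F.inf_le z)

lemma sqrt_a_pos : 0 < √F.a := sqrt_pos.2 F.a_pos

lemma sqrt_b_pos : 0 < √F.b := sqrt_pos.2 F.b_pos

lemma sqrt_rank_pos (F : GaussFamily V ι) : 0 < √(Module.finrank ℝ V : ℝ) :=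
  sqrt_pos.2 (by have := F.two_le; positivity)

/-- The values of the seminorms at `x`, reduced by the resolution of level `i`. -/
noncomputable def weight (i : ℕ) (x : V) (k : ι) : ℝ := max (F.N k x - 4 * √F.b * scale i) 0

lemma weight_nonneg (i : ℕ) (x : V) (k : ι) : 0 ≤ F.weight i x k := le_max_right _ _

/-- The seminorm defining the cell of `x` at level `i`. -/
noncomputable def cellSeminorm (i : ℕ) (x : V) : Seminorm ℝ V :=
  scaledSeminorm (1 / (4 * √F.b)) (by positivity) F.Ninf +
    (scaledSeminorm (1 / (8 * √(Module.finrank ℝ V : ℝ))) (by positivity) (normSeminorm ℝ V) +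
      scaledSeminorm (1 / (4 * √F.a)) (by positivity) (combSeminorm F.N (F.weight i x)))

lemma cellSeminorm_apply (i : ℕ) (x z : V) : F.cellSeminorm i x z =
    1 / (4 * √F.b) * F.Ninf z + (1 / (8 * √(Module.finrank ℝ V : ℝ)) * ‖z‖ +
      1 / (4 * √F.a) * combSeminorm F.N (F.weight i x) z) := rfl

lemma continuous_cellSeminorm (i : ℕ) (x : V) : Continuous (F.cellSeminorm i x) := by
  have h1 := F.continuous_inf
  have h2 := F.continuous_N
  change Continuous fun z => 1 / (4 * √F.b) * F.Ninf z +
    (1 / (8 * √(Module.finrank ℝ V : ℝ)) * ‖z‖ +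
      1 / (4 * √F.a) * √(∑ k, (F.weight i x k * F.N k z) ^ 2))
  fun_prop

lemma cellSeminorm_le_of_weight_le {i j : ℕ} {x y : V}
    (h : ∀ k, F.weight i x k ≤ F.weight j y k) (z : V) :
    F.cellSeminorm i x z ≤ F.cellSeminorm j y z := by
  rw [cellSeminorm_apply, cellSeminorm_apply]
  gcongr
  exact combSeminorm_mono F.N (F.weight_nonneg i x) h z

/-- The set of points controlled by the chain. -/
def body : Set V := {x | ‖x‖ ≤ 1 ∧ ∑ k, F.N k x ^ 2 ≤ 1}

lemma lintegral_cellSeminorm_sq_le (i : ℕ) {x : V} (hx : x ∈ F.body) :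
    ∫⁻ z, ENNReal.ofReal (F.cellSeminorm i x z ^ 2) ∂(gauss V) ≤ ENNReal.ofReal (9 / 16) := by
  have hn := F.two_le
  set n : ℝ := ((Module.finrank ℝ V : ℕ) : ℝ) with hnn
  have hn2 : (2 : ℝ) ≤ n := by rw [hnn]; exact_mod_cast hn
  have ha := F.a_pos
  have hb := F.b_pos
  have hmInf : Measurable fun z => ENNReal.ofReal (F.Ninf z ^ 2) :=
    (F.continuous_inf.pow 2).measurable.ennreal_ofReal
  have hmN : ∀ k, Measurable fun z => ENNReal.ofReal (F.N k z ^ 2) := fun k =>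
    ((F.continuous_N k).pow 2).measurable.ennreal_ofReal
  have hmnorm : Measurable fun z : V => ENNReal.ofReal (‖z‖ ^ 2) :=
    (continuous_norm.pow 2).measurable.ennreal_ofReal
  have hpt : ∀ z, ENNReal.ofReal (F.cellSeminorm i x z ^ 2) ≤
      ENNReal.ofReal (3 / (16 * F.b)) * ENNReal.ofReal (F.Ninf z ^ 2) +
      (ENNReal.ofReal (3 / (64 * n)) * ENNReal.ofReal (‖z‖ ^ 2) +
      ∑ k, ENNReal.ofReal (3 / (16 * F.a) * F.weight i x k ^ 2) *
        ENNReal.ofReal (F.N k z ^ 2)) := by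
    intro z
    have e : ∀ k ∈ Finset.univ, ENNReal.ofReal (3 / (16 * F.a) * F.weight i x k ^ 2) *
        ENNReal.ofReal (F.N k z ^ 2) =
        ENNReal.ofReal (3 / (16 * F.a) * F.weight i x k ^ 2 * F.N k z ^ 2) := fun k _ => by
      rw [← ENNReal.ofReal_mul (by positivity)]
    rw [Finset.sum_congr rfl e, ← ENNReal.ofReal_sum_of_nonneg (fun k _ => by positivity),
      ← ENNReal.ofReal_mul (by positivity), ← ENNReal.ofReal_mul (by positivity),
      ← ENNReal.ofReal_add (by positivity) (by positivity),
      ← ENNReal.ofReal_add (by positivity) (by positivity)]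
    apply ENNReal.ofReal_le_ofReal
    rw [cellSeminorm_apply, combSeminorm_apply]
    have h3 : ∀ p q r : ℝ, (p + (q + r)) ^ 2 ≤ 3 * p ^ 2 + (3 * q ^ 2 + 3 * r ^ 2) := by
      intro p q r
      nlinarith [sq_nonneg (p - q), sq_nonneg (p - r), sq_nonneg (q - r)]
    refine (h3 _ _ _).trans (le_of_eq ?_)
    have hsum : 0 ≤ ∑ k, (F.weight i x k * F.N k z) ^ 2 :=
      Finset.sum_nonneg fun k _ => sq_nonneg _
    simp only [mul_pow, div_pow]
    simp only [mul_pow] at hsum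
    rw [sq_sqrt hb.le, sq_sqrt ha.le, sq_sqrt (by positivity), sq_sqrt hsum]
    simp only [mul_assoc, ← Finset.mul_sum]
    congr 1
    · field_simp; norm_num; ring
    · congr 1
      · rw [← hnn]; field_simp; norm_num; ring
      · field_simp; norm_num; ring
  have hw : ∑ k, F.weight i x k ^ 2 ≤ 1 := by
    refine le_trans (Finset.sum_le_sum fun k _ => ?_) hx.2
    refine pow_le_pow_left₀ (F.weight_nonneg i x k) (max_le ?_ (apply_nonneg _ _)) 2
    have := F.sqrt_b_pos
    have := scale_pos i
    have : 0 ≤ 4 * √F.b * scale i := by positivity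
    linarith
  calc _ ≤ ∫⁻ z, (ENNReal.ofReal (3 / (16 * F.b)) * ENNReal.ofReal (F.Ninf z ^ 2) +
      (ENNReal.ofReal (3 / (64 * n)) * ENNReal.ofReal (‖z‖ ^ 2) +
      ∑ k, ENNReal.ofReal (3 / (16 * F.a) * F.weight i x k ^ 2) *
        ENNReal.ofReal (F.N k z ^ 2))) ∂(gauss V) := lintegral_mono hpt
    _ = ENNReal.ofReal (3 / (16 * F.b)) * ∫⁻ z, ENNReal.ofReal (F.Ninf z ^ 2) ∂(gauss V) +
      (ENNReal.ofReal (3 / (64 * n)) * ∫⁻ z : V, ENNReal.ofReal (‖z‖ ^ 2) ∂(gauss V) +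
      ∑ k, ENNReal.ofReal (3 / (16 * F.a) * F.weight i x k ^ 2) *
        ∫⁻ z, ENNReal.ofReal (F.N k z ^ 2) ∂(gauss V)) := by
        rw [lintegral_add_left (hmInf.const_mul _), lintegral_add_left (hmnorm.const_mul _),
          lintegral_const_mul _ hmInf, lintegral_const_mul _ hmnorm,
          lintegral_finsetSum _ fun k _ => (hmN k).const_mul _]
        simp only [lintegral_const_mul _ (hmN _)]
    _ ≤ ENNReal.ofReal (3 / (16 * F.b)) * ENNReal.ofReal F.b +
      (ENNReal.ofReal (3 / (64 * n)) * ENNReal.ofReal (2 * n + 4) +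
      ∑ k, ENNReal.ofReal (3 / (16 * F.a) * F.weight i x k ^ 2) * ENNReal.ofReal F.a) := by
        gcongr with k
        · exact F.int_inf_le
        · exact lintegral_gauss_norm_sq
        · exact F.int_le k
    _ = ENNReal.ofReal (3 / (16 * F.b) * F.b + (3 / (64 * n) * (2 * n + 4) +
        ∑ k, 3 / (16 * F.a) * F.weight i x k ^ 2 * F.a)) := by
        have hs : 0 ≤ ∑ k, 3 / (16 * F.a) * F.weight i x k ^ 2 * F.a :=
          Finset.sum_nonneg fun k _ => by positivity
        rw [ENNReal.ofReal_add (p := 3 / (16 * F.b) * F.b) (by positivity) (by positivity),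
          ENNReal.ofReal_add (p := 3 / (64 * n) * (2 * n + 4)) (by positivity) hs,
          ENNReal.ofReal_sum_of_nonneg (fun k _ => by positivity),
          ENNReal.ofReal_mul (p := 3 / (16 * F.b)) (by positivity),
          ENNReal.ofReal_mul (p := 3 / (64 * n)) (by positivity)]
        congr 2
        exact Finset.sum_congr rfl fun k _ => (ENNReal.ofReal_mul (by positivity)).symm
    _ ≤ _ := by
        apply ENNReal.ofReal_le_ofReal
        have e1 : 3 / (16 * F.b) * F.b = 3 / 16 := by field_simp
        have e2 : 3 / (64 * n) * (2 * n + 4) ≤ 3 / 16 := by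
          rw [div_mul_eq_mul_div, div_le_div_iff₀ (by positivity) (by norm_num)]
          linarith
        have e3 : ∑ k, 3 / (16 * F.a) * F.weight i x k ^ 2 * F.a =
            3 / 16 * ∑ k, F.weight i x k ^ 2 := by
          rw [Finset.mul_sum]
          exact Finset.sum_congr rfl fun k _ => by field_simp
        rw [e1, e3]
        linarith

lemma gauss_cellSeminorm_le_one (i : ℕ) {x : V} (hx : x ∈ F.body) :
    ENNReal.ofReal (1 / 4) ≤ gauss V {z | F.cellSeminorm i x z ≤ 1} := by
  have hm : MeasurableSet {z | F.cellSeminorm i x z ≤ 1} :=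
    (isClosed_le (F.continuous_cellSeminorm i x) continuous_const).measurableSet
  have h1 : gauss V {z | F.cellSeminorm i x z ≤ 1}ᶜ ≤ ENNReal.ofReal (9 / 16) := by
    refine le_trans ?_ (F.lintegral_cellSeminorm_sq_le i hx)
    have h2 := mul_meas_ge_le_lintegral (μ := gauss V)
      (f := fun z => ENNReal.ofReal (F.cellSeminorm i x z ^ 2))
      ((F.continuous_cellSeminorm i x).pow 2).measurable.ennreal_ofReal 1
    rw [one_mul] at h2
    refine le_trans (measure_mono fun z hz => ?_) h2
    have hz' : 1 < F.cellSeminorm i x z := not_le.1 hz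
    change (1 : ENNReal) ≤ ENNReal.ofReal _
    rw [ENNReal.one_le_ofReal]
    nlinarith
  have h2 := prob_add_prob_compl (μ := gauss V) hm
  by_contra! hlt
  have h3 := ENNReal.add_lt_add_of_lt_of_le (ne_top_of_le_ne_top ENNReal.ofReal_ne_top h1) hlt h1
  rw [h2, ← ENNReal.ofReal_add (by norm_num) (by norm_num), ENNReal.one_lt_ofReal] at h3
  norm_num at h3

/-- The cells attached to a family of seminorms. -/
noncomputable def cells : CellSystem V where
  D := F.cellSeminorm
  D₀ := scaledSeminorm (1 / (4 * √F.b)) (by positivity) F.Ninf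
  T := F.body
  R := 8 * √(Module.finrank ℝ V : ℝ)
  cont := F.continuous_cellSeminorm
  mono i x z := by
    refine F.cellSeminorm_le_of_weight_le (fun k => max_le_max ?_ le_rfl) z
    have := scale_succ_le i
    gcongr
  base_le i x z := by
    rw [cellSeminorm_apply, scaledSeminorm_apply]
    have : 0 ≤ 1 / (8 * √(Module.finrank ℝ V : ℝ)) * ‖z‖ := by positivity
    have : 0 ≤ 1 / (4 * √F.a) * combSeminorm F.N (F.weight i x) z :=
      mul_nonneg (by positivity) (apply_nonneg _ _)
    linarith
  comp i x x' h z := by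
    refine F.cellSeminorm_le_of_weight_le (fun k => max_le_max ?_ le_rfl) z
    have hb := F.sqrt_b_pos
    rw [scaledSeminorm_apply, one_div, inv_mul_le_iff₀ (by positivity)] at h
    have h1 := F.le_inf k (x - x')
    have h2 : F.N k x ≤ F.N k (x - x') + F.N k x' := by
      have := map_add_le_add (F.N k) (x - x') x'
      rwa [sub_add_cancel] at this
    have h3 : 0 ≤ 4 * √F.b * scale (i + 1) := by have := scale_pos (i + 1); positivity
    have h4 : 4 * √F.b * scale i = 4 * (4 * √F.b * scale (i + 1)) := by rw [scale_succ]; ring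
    linarith
  good i x hx := F.gauss_cellSeminorm_le_one i hx
  norm_le i x z := by
    have hn := F.sqrt_rank_pos
    rw [cellSeminorm_apply]
    have h1 : 0 ≤ 1 / (4 * √F.b) * F.Ninf z := mul_nonneg (by positivity) (apply_nonneg _ _)
    have h2 : 0 ≤ 1 / (4 * √F.a) * combSeminorm F.N (F.weight i x) z :=
      mul_nonneg (by positivity) (apply_nonneg _ _)
    calc ‖z‖ = 8 * √(Module.finrank ℝ V : ℝ) * (1 / (8 * √(Module.finrank ℝ V : ℝ)) * ‖z‖) := by
          field_simp
      _ ≤ _ := by gcongr; linarith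
  R_nonneg := by positivity
  T_le x hx := hx.1

end GaussFamily

end Family

section Clip

/-- The square of `v`, reduced by the square of the resolution `l`. -/
noncomputable def clip (l v : ℝ) : ℝ := max (v ^ 2 - l ^ 2) 0

lemma clip_eq_zero {l v : ℝ} (hv : 0 ≤ v) (h : v ≤ l) : clip l v = 0 :=
  max_eq_right (by nlinarith)

lemma abs_clip_sub_le {l t u u' : ℝ} (ht : |t - u| ≤ l / 12) (ht' : |t - u'| ≤ l / 12)
    (hu : 0 ≤ u) (hu' : 0 ≤ u') :
    |clip l u' - clip l u| ≤ 4 * max (t - l / 3) 0 * |u' - u| := by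
  by_cases h : u ≤ l ∧ u' ≤ l
  · rw [clip_eq_zero hu h.1, clip_eq_zero hu' h.2, sub_zero, abs_zero]
    positivity
  · rw [abs_le] at ht ht'
    have h1 : |clip l u' - clip l u| ≤ |u' ^ 2 - u ^ 2| := by
      refine (abs_max_sub_max_le_abs _ _ _).trans (le_of_eq ?_)
      congr 1
      ring
    have ht11 : 11 / 12 * l ≤ t := by
      by_contra! hc
      exact h ⟨by linarith [ht.1, ht.2], by linarith [ht'.1, ht'.2]⟩
    have hl : 0 ≤ l := by linarith [ht.1, ht.2]
    refine h1.trans ?_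
    have e : u' ^ 2 - u ^ 2 = (u' + u) * (u' - u) := by ring
    rw [e, abs_mul, abs_of_nonneg (add_nonneg hu' hu)]
    have := le_max_left (t - l / 3) 0
    gcongr
    linarith [ht.1, ht.2, ht'.1, ht'.2]

lemma abs_clip_sub_clip_le {l t u : ℝ} (hu : 0 ≤ u) (ht : |t - u| ≤ l / 48) :
    |clip (l / 4) u - clip l u| ≤ if l ≤ 8 * t then l ^ 2 else 0 := by
  rw [abs_le] at ht
  split_ifs with h
  · refine (abs_max_sub_max_le_abs _ _ _).trans ?_
    have e : u ^ 2 - (l / 4) ^ 2 - (u ^ 2 - l ^ 2) = 15 / 16 * l ^ 2 := by ring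
    rw [e, abs_of_nonneg (by positivity)]
    nlinarith [sq_nonneg l]
  · push Not at h
    rw [clip_eq_zero hu (by linarith [ht.1]), clip_eq_zero hu (by linarith [ht.1]), sub_zero,
      abs_zero]

end Clip

section Increments

variable {V : Type} [NormedAddCommGroup V] [InnerProductSpace ℝ V] [FiniteDimensional ℝ V]
  [MeasurableSpace V] [BorelSpace V] {ι : Type} [Fintype ι]

namespace GaussFamily

variable (F : GaussFamily V ι)

/-- The resolution at which squares are clipped at level `i`. -/
noncomputable def level (i : ℕ) : ℝ := 3 * √F.b * scale i

lemma level_pos (i : ℕ) : 0 < F.level i := by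
  have := F.sqrt_b_pos
  have := scale_pos i
  unfold level
  positivity

lemma level_succ (i : ℕ) : F.level (i + 1) = F.level i / 4 := by
  unfold level; rw [scale_succ]; ring

/-- The contribution of level `i` to the squares of the seminorms at `x`. -/
noncomputable def energy (i : ℕ) (x : V) : ℝ :=
  ∑ k, if F.level i ≤ 8 * F.N k x then F.level i ^ 2 else 0

lemma energy_nonneg (i : ℕ) (x : V) : 0 ≤ F.energy i x :=
  Finset.sum_nonneg fun k _ => by split_ifs <;> positivity

lemma sum_energy_le {x : V} (hx : x ∈ F.body) (I : ℕ) : ∑ i ∈ range I, F.energy i x ≤ 70 := by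
  have key : ∀ t : ℝ, 0 ≤ t → ∑ i ∈ range I, (if F.level i ≤ t then F.level i ^ 2 else 0) ≤
      16 / 15 * t ^ 2 := by
    intro t ht
    have h1 : ∀ i, (if F.level i ≤ t then F.level i ^ 2 else 0) ≤
        16 / 15 * (min (F.level i) t ^ 2 - min (F.level (i + 1)) t ^ 2) := by
      intro i
      have hl := F.level_pos i
      have hs := F.level_succ i
      split_ifs with h
      · rw [min_eq_left h, min_eq_left (by linarith), hs]
        nlinarith
      · have h2 : min (F.level (i + 1)) t ≤ min (F.level i) t := min_le_min_right _ (by linarith)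
        have h3 : 0 ≤ min (F.level (i + 1)) t := le_min (F.level_pos _).le ht
        nlinarith
    refine (Finset.sum_le_sum fun i _ => h1 i).trans ?_
    rw [← Finset.mul_sum, Finset.sum_range_sub' (fun i => min (F.level i) t ^ 2)]
    have h2 : min (F.level 0) t ^ 2 ≤ t ^ 2 :=
      pow_le_pow_left₀ (le_min (F.level_pos _).le ht) (min_le_right _ _) 2
    nlinarith [sq_nonneg (min (F.level I) t)]
  unfold energy
  rw [Finset.sum_comm]
  have hx2 := hx.2
  calc _ ≤ ∑ k, 16 / 15 * (8 * F.N k x) ^ 2 := Finset.sum_le_sum fun k _ =>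
        key _ (mul_nonneg (by norm_num) (apply_nonneg _ _))
    _ = 16 / 15 * 64 * ∑ k, F.N k x ^ 2 := by
        rw [Finset.mul_sum]; exact Finset.sum_congr rfl fun k _ => by ring
    _ ≤ _ := by linarith

lemma abs_sub_le_of_near {i : ℕ} {x q : V} (h : F.cells.Near (i + 2) x q) (k : ι) :
    |F.N k x - F.N k q| ≤ F.level i / 12 := by
  have hb := F.sqrt_b_pos
  have h1 : 1 / (4 * √F.b) * F.Ninf (x - q) ≤ scale (i + 2) := (F.cells.base_le _ _ _).trans h.1
  rw [one_div, inv_mul_le_iff₀ (by positivity)] at h1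
  refine (abs_sub_map_le_sub (F.N k) x q).trans ((F.le_inf k _).trans (h1.trans (le_of_eq ?_)))
  unfold level
  rw [scale_succ, scale_succ]
  ring

lemma combSeminorm_le_cell (i : ℕ) (x z : V) :
    combSeminorm F.N (F.weight i x) z ≤ 4 * √F.a * F.cellSeminorm i x z := by
  have ha := F.sqrt_a_pos
  rw [cellSeminorm_apply]
  have h1 : 0 ≤ 1 / (4 * √F.b) * F.Ninf z := mul_nonneg (by positivity) (apply_nonneg _ _)
  have h2 : 0 ≤ 1 / (8 * √(Module.finrank ℝ V : ℝ)) * ‖z‖ := by positivity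
  calc _ = 4 * √F.a * (1 / (4 * √F.a) * combSeminorm F.N (F.weight i x) z) := by field_simp
    _ ≤ _ := by gcongr; linarith

/-- The increment of the clipped squares along one link of the chain. -/
noncomputable def link (i : ℕ) (q q' : V) (k : ι) : ℝ :=
  clip (F.level (i + 1)) (F.N k q') - clip (F.level i) (F.N k q)

lemma sqrt_sum_link_sq_le {i : ℕ} {x q q' : V} (hq : F.cells.Near (i + 2) x q)
    (hq' : F.cells.Near (i + 3) x q') :
    √(∑ k, F.link i q q' k ^ 2) ≤ scale i * (2 * √F.a + 3 * √F.b * √(F.energy i x)) := by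
  have hs := scale_pos i
  have ha := F.sqrt_a_pos
  have hb := F.sqrt_b_pos
  have hl := F.level_pos i
  have hN : ∀ k z, 0 ≤ F.N k z := fun k z => apply_nonneg _ _
  have hd : ∀ k, |F.N k x - F.N k q| ≤ F.level i / 12 := F.abs_sub_le_of_near hq
  have hd' : ∀ k, |F.N k x - F.N k q'| ≤ F.level i / 48 := fun k => by
    have := F.abs_sub_le_of_near hq' k
    rw [level_succ] at this
    linarith
  set u : ι → ℝ := fun k => clip (F.level i) (F.N k q') - clip (F.level i) (F.N k q) with hu
  set v : ι → ℝ := fun k => clip (F.level (i + 1)) (F.N k q') - clip (F.level i) (F.N k q') with hv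
  have hsplit : ∀ k, F.link i q q' k = v k + u k := fun k => by simp only [link, hu, hv]; ring
  have h1 : √(∑ k, u k ^ 2) ≤ scale i * (2 * √F.a) := by
    have hw : F.level i / 3 = 4 * √F.b * scale (i + 1) := by
      unfold level; rw [scale_succ]; ring
    have hpt : ∀ k, u k ^ 2 ≤ 4 ^ 2 * (F.weight (i + 1) x k * F.N k (q' - q)) ^ 2 := by
      intro k
      have h2 := abs_clip_sub_le (hd k) ((hd' k).trans (by linarith)) (hN k q) (hN k q')
      rw [hw] at h2
      have h3 := abs_sub_map_le_sub (F.N k) q' q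
      have h4 : |u k| ≤ 4 * (F.weight (i + 1) x k * F.N k (q' - q)) := by
        refine h2.trans ?_
        rw [mul_assoc]
        have := F.weight_nonneg (i + 1) x k
        unfold weight at *
        gcongr
      rw [← mul_pow, ← sq_abs]
      exact pow_le_pow_left₀ (abs_nonneg _) h4 2
    have h5 : √(∑ k, u k ^ 2) ≤ 4 * combSeminorm F.N (F.weight (i + 1) x) (q' - q) := by
      rw [combSeminorm_apply, ← sqrt_sq (show (0 : ℝ) ≤ 4 by norm_num),
        ← sqrt_mul (by norm_num), Finset.mul_sum]
      exact sqrt_le_sqrt (Finset.sum_le_sum fun k _ => hpt k)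
    have e : q' - q = (x - q) - (x - q') := by abel
    have h6 : F.cellSeminorm (i + 1) x (q' - q) ≤ 2 * scale (i + 2) := by
      rw [e]
      refine (map_sub_le_add _ _ _).trans ?_
      have a1 : F.cellSeminorm (i + 1) x (x - q) ≤ F.cellSeminorm (i + 2) x (x - q) :=
        F.cells.mono (i + 1) x _
      have a2 : F.cellSeminorm (i + 2) x (x - q) ≤ scale (i + 2) := hq.1
      have a3 : F.cellSeminorm (i + 1) x (x - q') ≤ F.cellSeminorm (i + 2) x (x - q') :=
        F.cells.mono (i + 1) x _
      have a4 : F.cellSeminorm (i + 2) x (x - q') ≤ F.cellSeminorm (i + 3) x (x - q') :=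
        F.cells.mono (i + 2) x _
      have a5 : F.cellSeminorm (i + 3) x (x - q') ≤ scale (i + 3) := hq'.1
      have a6 := scale_succ_le (i + 2)
      linarith
    have h7 := F.combSeminorm_le_cell (i + 1) x (q' - q)
    have h8 : 4 * √F.a * F.cellSeminorm (i + 1) x (q' - q) ≤ 4 * √F.a * (2 * scale (i + 2)) := by
      gcongr
    have h9 : scale (i + 2) = scale i / 16 := by
      rw [scale_succ, scale_succ]; ring
    rw [h9] at h8
    linarith
  have h2 : √(∑ k, v k ^ 2) ≤ scale i * (3 * √F.b * √(F.energy i x)) := by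
    have e : scale i * (3 * √F.b * √(F.energy i x)) = √(F.level i ^ 2 * F.energy i x) := by
      rw [sqrt_mul (sq_nonneg _), sqrt_sq hl.le]; unfold level; ring
    rw [e]
    refine sqrt_le_sqrt ?_
    unfold energy
    rw [Finset.mul_sum]
    refine Finset.sum_le_sum fun k _ => ?_
    have h3 := abs_clip_sub_clip_le (hN k q') (hd' k)
    rw [← level_succ] at h3
    change |v k| ≤ _ at h3
    rw [← sq_abs]
    refine (pow_le_pow_left₀ (abs_nonneg _) h3 2).trans (le_of_eq ?_)
    split_ifs <;> ring
  have h3 := sqrt_sum_add_sq_le v u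
  simp only [hsplit]
  linarith

lemma inf_le_sqrt_of_mem {x : V} (hx : x ∈ F.body) : F.Ninf x ≤ √F.b :=
  (F.inf_le x).trans (mul_le_of_le_one_right (sqrt_nonneg _) hx.1)

lemma clip_level_zero {q : V} (hq : q ∈ F.body) (k : ι) : clip (F.level 0) (F.N k q) = 0 := by
  refine clip_eq_zero (apply_nonneg _ _) ?_
  have h1 := F.le_inf k q
  have h2 := F.inf_le_sqrt_of_mem hq
  have := F.sqrt_b_pos
  unfold level
  rw [scale_zero]
  linarith

lemma abs_sq_sub_clip_le {i : ℕ} {x q : V} (hx : x ∈ F.body) (hq : q ∈ F.body)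
    (h : F.cells.Near (i + 2) x q) (k : ι) :
    |F.N k x ^ 2 - clip (F.level i) (F.N k q)| ≤ 10 * F.b * scale i := by
  have hb := F.sqrt_b_pos
  have hb2 : √F.b ^ 2 = F.b := sq_sqrt F.b_pos.le
  have hs := scale_pos i
  have hs1 : scale i ≤ 1 := by unfold scale; exact pow_le_one₀ (by norm_num) (by norm_num)
  have h1 := F.abs_sub_le_of_near h k
  have hx0 : 0 ≤ F.N k x := apply_nonneg _ _
  have hq0 : 0 ≤ F.N k q := apply_nonneg _ _
  have hx1 := (F.le_inf k x).trans (F.inf_le_sqrt_of_mem hx)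
  have hq1 := (F.le_inf k q).trans (F.inf_le_sqrt_of_mem hq)
  have h2 : |F.N k x ^ 2 - F.N k q ^ 2| ≤ F.b * scale i / 2 := by
    have e : F.N k x ^ 2 - F.N k q ^ 2 = (F.N k x + F.N k q) * (F.N k x - F.N k q) := by ring
    rw [e, abs_mul, abs_of_nonneg (add_nonneg hx0 hq0)]
    calc _ ≤ (√F.b + √F.b) * (F.level i / 12) := by gcongr
      _ = √F.b ^ 2 * scale i / 2 := by unfold level; ring
      _ = _ := by rw [hb2]
  have h3 : |F.N k q ^ 2 - clip (F.level i) (F.N k q)| ≤ 9 * F.b * scale i := by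
    have hlev : F.level i ^ 2 ≤ 9 * F.b * scale i := by
      have : F.level i ^ 2 = 9 * √F.b ^ 2 * scale i ^ 2 := by unfold level; ring
      rw [this, hb2]
      have := F.b_pos
      gcongr
      nlinarith
    unfold clip
    rw [abs_le]
    constructor
    · rcases max_cases (F.N k q ^ 2 - F.level i ^ 2) 0 with ⟨h, _⟩ | ⟨h, _⟩ <;> rw [h] <;>
        nlinarith [sq_nonneg (F.level i)]
    · linarith [le_max_left (F.N k q ^ 2 - F.level i ^ 2) 0]
  have h4 := abs_sub_le (F.N k x ^ 2) (F.N k q ^ 2) (clip (F.level i) (F.N k q))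
  have : 0 ≤ F.b * scale i := by have := F.b_pos; positivity
  linarith

end GaussFamily

end Increments

section Discrepancy

variable {V : Type} [NormedAddCommGroup V] [InnerProductSpace ℝ V] [FiniteDimensional ℝ V]
  [MeasurableSpace V] [BorelSpace V] {ι : Type} [Fintype ι]

namespace GaussFamily

variable (F : GaussFamily V ι)

/-- A single choice of signs controls the signed sums of all links of the chain. -/
lemma exists_signs_link (I : ℕ) : ∃ e : ι → Bool, ∀ x ∈ F.body, ∃ q : ℕ → V,
    (∀ i, q i ∈ F.body) ∧ (∀ i, F.cells.Near (i + 2) x (q i)) ∧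
    ∀ i < I, |∑ k, boolSign (e k) * F.link i (q i) (q (i + 1)) k| ≤
      √(∑ k, F.link i (q i) (q (i + 1)) k ^ 2) * √(6 * F.cells.cost (i + 1) x) := by
  choose Q hQ pt p hp hsum hT hnet using fun i => F.cells.exists_weighted_net i
  let w : (Σ i : Fin I, Q i × Q (i + 1)) → ℝ := fun a =>
    (1 / 2) ^ ((a.1 : ℕ) + 1) * (p a.1 a.2.1 * p (a.1 + 1) a.2.2)
  have hw : ∀ a, 0 < w a := fun a =>
    mul_pos (by positivity) (mul_pos (hp _ _) (hp _ _))
  have hws : ∑ a, w a ≤ 1 := by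
    rw [Fintype.sum_sigma]
    have h1 : ∀ i : Fin I, ∑ y : Q i × Q (i + 1), w ⟨i, y⟩ ≤ (1 / 2) ^ ((i : ℕ) + 1) := by
      intro i
      simp only [w]
      rw [← Finset.mul_sum, Fintype.sum_prod_type]
      refine mul_le_of_le_one_right (by positivity) ?_
      simp only [← Finset.mul_sum]
      rw [← Finset.sum_mul]
      exact mul_le_one₀ (hsum i) (Finset.sum_nonneg fun q _ => (hp _ q).le) (hsum (i + 1))
    refine (Finset.sum_le_sum fun i _ => h1 i).trans ?_
    rw [Fin.sum_univ_eq_sum_range (fun i => (1 / 2 : ℝ) ^ (i + 1)) I]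
    have h2 : ∀ m : ℕ, ∑ i ∈ range m, (1 / 2 : ℝ) ^ (i + 1) = 1 - (1 / 2) ^ m := by
      intro m
      induction m with
      | zero => simp
      | succ m ih => rw [Finset.sum_range_succ, ih]; ring
    rw [h2]
    have : (0 : ℝ) < (1 / 2) ^ I := by positivity
    linarith
  obtain ⟨e, he⟩ := exists_signs w hw hws
    (fun a k => F.link a.1 (pt a.1 a.2.1) (pt (a.1 + 1) a.2.2) k)
  refine ⟨e, fun x hx => ?_⟩
  choose q hq hc using fun i => hnet i x hx
  refine ⟨fun i => pt i (q i), fun i => hT _ _, hq, fun i hi => ?_⟩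
  refine (he ⟨⟨i, hi⟩, (q i, q (i + 1))⟩).trans ?_
  refine mul_le_mul_of_nonneg_left (sqrt_le_sqrt ?_) (sqrt_nonneg _)
  have h1 : log (2 / w ⟨⟨i, hi⟩, (q i, q (i + 1))⟩) =
      ((i : ℝ) + 2) * log 2 + (log (1 / p i (q i)) + log (1 / p (i + 1) (q (i + 1)))) := by
    have a1 := hp i (q i)
    have a2 := hp (i + 1) (q (i + 1))
    simp only [w]
    rw [log_div (by norm_num) (by positivity), log_mul (by positivity) (by positivity),
      log_mul a1.ne' a2.ne', log_pow, one_div, log_inv, one_div, log_inv, one_div, log_inv]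
    push_cast
    ring
  have h2 := hc i
  have h3 := hc (i + 1)
  have h4 := F.cells.one_le_cost (i + 1) x
  have h5 := F.cells.cost_le_succ i x
  have h6 : log 2 ≤ 1 := by linarith [log_two_lt_d9]
  push_cast at h4
  have h7 : ((i : ℝ) + 2) * log 2 ≤ (i : ℝ) + 2 :=
    mul_le_of_le_one_right (by positivity) h6
  rw [h1]
  have : (0 : ℝ) ≤ i := Nat.cast_nonneg i
  norm_num at h4
  linarith

/-- Signs for which the signed sum of the squared seminorms is uniformly small. -/
theorem exists_signs_body : ∃ e : ι → Bool, ∀ x ∈ F.body,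
    |∑ k, boolSign (e k) * F.N k x ^ 2| ≤
      2 ^ 30 * (√(F.a * log (Module.finrank ℝ V)) + √F.b) := by
  have ha := F.sqrt_a_pos
  have hb := F.sqrt_b_pos
  have hbp := F.b_pos
  obtain ⟨I, hI⟩ : ∃ I : ℕ, Fintype.card ι * (10 * F.b * scale I) ≤ √F.b := by
    obtain ⟨I, hI⟩ := exists_pow_lt_of_lt_one
      (show 0 < √F.b / (Fintype.card ι * (10 * F.b) + 1) by positivity)
      (show (1 / 4 : ℝ) < 1 by norm_num)
    refine ⟨I, ?_⟩
    rw [lt_div_iff₀ (by positivity)] at hI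
    have := scale_pos I
    change scale I * _ < _ at hI
    nlinarith
  obtain ⟨e, he⟩ := F.exists_signs_link I
  refine ⟨e, fun x hx => ?_⟩
  obtain ⟨q, hq, hnear, hlink⟩ := he x hx
  set n := Module.finrank ℝ V
  have hs1 : ∀ k, |boolSign (e k)| = 1 := fun k => by
    rcases boolSign_cases (e k) with h | h <;> rw [h] <;> simp
  have hend : |∑ k, boolSign (e k) * (F.N k x ^ 2 - clip (F.level I) (F.N k (q I)))| ≤ √F.b := by
    refine (Finset.abs_sum_le_sum_abs _ _).trans (le_trans ?_ hI)
    calc _ ≤ ∑ k : ι, 10 * F.b * scale I := Finset.sum_le_sum fun k _ => by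
          rw [abs_mul, hs1, one_mul]
          exact F.abs_sq_sub_clip_le hx (hq I) (hnear I) k
      _ = _ := by simp
  have htel : ∑ k, boolSign (e k) * clip (F.level I) (F.N k (q I)) =
      ∑ i ∈ range I, ∑ k, boolSign (e k) * F.link i (q i) (q (i + 1)) k := by
    rw [Finset.sum_comm]
    refine Finset.sum_congr rfl fun k _ => ?_
    rw [← Finset.mul_sum]
    congr 1
    unfold link
    rw [Finset.sum_range_sub (fun i => clip (F.level i) (F.N k (q i))) I,
      F.clip_level_zero (hq 0), sub_zero]
  have h6 : √6 ≤ 2.5 := by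
    rw [sqrt_le_left (by norm_num)]; norm_num
  have hstep : ∀ i ∈ range I, |∑ k, boolSign (e k) * F.link i (q i) (q (i + 1)) k| ≤
      5 * √F.a * (scale i * √(F.cells.cost (i + 1) x)) +
        3.75 * √F.b * (F.energy i x + scale i ^ 2 * F.cells.cost (i + 1) x) := by
    intro i hi
    have hc := F.cells.cost_nonneg (i + 1) x
    have hs := scale_pos i
    have hen := F.energy_nonneg i x
    refine (hlink i (mem_range.1 hi)).trans ?_
    have h1 := F.sqrt_sum_link_sq_le (hnear i) (hnear (i + 1))
    rw [sqrt_mul (by norm_num)]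
    set s := √(F.cells.cost (i + 1) x) with hsdef
    set t := √(F.energy i x) with htdef
    have hs0 : 0 ≤ s := sqrt_nonneg _
    have ht0 : 0 ≤ t := sqrt_nonneg _
    have e1 : s ^ 2 = F.cells.cost (i + 1) x := sq_sqrt hc
    have e2 : t ^ 2 = F.energy i x := sq_sqrt hen
    rw [← e1, ← e2]
    calc _ ≤ scale i * (2 * √F.a + 3 * √F.b * t) * (2.5 * s) := by gcongr
      _ ≤ _ := by
        have h2 : √F.b * (2 * (t * (scale i * s))) ≤ √F.b * (t ^ 2 + (scale i * s) ^ 2) := by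
          gcongr
          nlinarith [sq_nonneg (t - scale i * s)]
        nlinarith
  have hR : F.cells.R ≤ 8 * √(n : ℝ) := le_rfl
  have hx' : x ∈ F.cells.T := hx
  have s1 := F.cells.sum_scale_sqrt_cost_le F.two_le hR hx' I
  have s2 := F.cells.sum_scale_sq_cost_le hx' I
  have s3 := F.sum_energy_le hx I
  have hmain : |∑ k, boolSign (e k) * clip (F.level I) (F.N k (q I))| ≤
      5 * √F.a * (2 ^ 16 * √(log n)) + 3.75 * √F.b * (70 + 4 ^ 12) := by
    rw [htel]
    refine (Finset.abs_sum_le_sum_abs _ _).trans ((Finset.sum_le_sum hstep).trans ?_)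
    rw [Finset.sum_add_distrib, ← Finset.mul_sum, ← Finset.mul_sum, Finset.sum_add_distrib]
    gcongr
  have hsplit : ∑ k, boolSign (e k) * F.N k x ^ 2 =
      ∑ k, boolSign (e k) * (F.N k x ^ 2 - clip (F.level I) (F.N k (q I))) +
        ∑ k, boolSign (e k) * clip (F.level I) (F.N k (q I)) := by
    rw [← Finset.sum_add_distrib]
    exact Finset.sum_congr rfl fun k _ => by ring
  rw [hsplit, sqrt_mul F.a_pos.le]
  refine (abs_add_le _ _).trans ((add_le_add hend hmain).trans ?_)
  have : 0 ≤ √F.a * √(log n) := by positivity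
  nlinarith

end GaussFamily

end Discrepancy

section EdgeMax

variable {n : ℕ}

/-- The maximum of `d i j` over pairs of vertices of `S`. -/
noncomputable def edgeMax (S : Finset (Fin n)) (d : Fin n → Fin n → ℝ) : ℝ :=
  if h : (S ×ˢ S).Nonempty then (S ×ˢ S).sup' h (fun q => d q.1 q.2) else 0

lemma edgeEnergy_eq_edgeMax (S : Finset (Fin n)) (x : Fin n → ℝ) :
    edgeEnergy S x = edgeMax S fun i j => (x i - x j) ^ 2 := rfl

lemma le_edgeMax {S : Finset (Fin n)} (d : Fin n → Fin n → ℝ) {i j : Fin n} (hi : i ∈ S)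
    (hj : j ∈ S) : d i j ≤ edgeMax S d := by
  have h : (S ×ˢ S).Nonempty := ⟨(i, j), mk_mem_product hi hj⟩
  rw [edgeMax, dif_pos h]
  exact Finset.le_sup' (fun q : Fin n × Fin n => d q.1 q.2) (mk_mem_product hi hj)

lemma exists_edgeMax_eq {S : Finset (Fin n)} (hS : S.Nonempty) (d : Fin n → Fin n → ℝ) :
    ∃ i ∈ S, ∃ j ∈ S, edgeMax S d = d i j := by
  have h : (S ×ˢ S).Nonempty := hS.product hS
  obtain ⟨q, hq, he⟩ := Finset.exists_mem_eq_sup' h (fun q : Fin n × Fin n => d q.1 q.2)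
  rw [mem_product] at hq
  exact ⟨q.1, hq.1, q.2, hq.2, by rw [edgeMax, dif_pos h, he]⟩

lemma edgeMax_nonneg (S : Finset (Fin n)) (d : Fin n → Fin n → ℝ) (hd : ∀ i j, 0 ≤ d i j) :
    0 ≤ edgeMax S d := by
  rcases S.eq_empty_or_nonempty with rfl | hS
  · simp [edgeMax]
  · obtain ⟨i, _, j, _, h⟩ := exists_edgeMax_eq hS d
    rw [h]; exact hd i j

lemma edgeMax_le (S : Finset (Fin n)) (d : Fin n → Fin n → ℝ) {c : ℝ} (hc : 0 ≤ c)
    (hd : ∀ i ∈ S, ∀ j ∈ S, d i j ≤ c) : edgeMax S d ≤ c := by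
  rcases S.eq_empty_or_nonempty with rfl | hS
  · simpa [edgeMax] using hc
  · obtain ⟨i, hi, j, hj, h⟩ := exists_edgeMax_eq hS d
    rw [h]; exact hd i hi j hj

lemma edgeMax_mul (S : Finset (Fin n)) (d : Fin n → Fin n → ℝ) (hd : ∀ i j, 0 ≤ d i j) {c : ℝ}
    (hc : 0 ≤ c) : edgeMax S (fun i j => c * d i j) = c * edgeMax S d := by
  apply le_antisymm
  · exact edgeMax_le _ _ (mul_nonneg hc (edgeMax_nonneg _ _ hd)) fun i hi j hj =>
      mul_le_mul_of_nonneg_left (le_edgeMax d hi hj) hc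
  · rcases S.eq_empty_or_nonempty with rfl | hS
    · simp [edgeMax]
    · obtain ⟨i, hi, j, hj, h⟩ := exists_edgeMax_eq hS d
      rw [h]; exact le_edgeMax (fun i j => c * d i j) hi hj

lemma continuous_edgeMax {X : Type*} [TopologicalSpace X] (S : Finset (Fin n))
    (d : X → Fin n → Fin n → ℝ) (hd : ∀ i j, Continuous fun t => d t i j) :
    Continuous fun t => edgeMax S (d t) := by
  unfold edgeMax
  by_cases h : (S ×ˢ S).Nonempty
  · simp only [dif_pos h]
    exact Continuous.finset_sup'_apply h fun q _ => hd q.1 q.2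
  · simp only [dif_neg h]
    exact continuous_const

lemma edgeEnergy_nonneg (S : Finset (Fin n)) (x : Fin n → ℝ) : 0 ≤ edgeEnergy S x :=
  edgeMax_nonneg S (fun i j => (x i - x j) ^ 2) fun _ _ => sq_nonneg _

lemma edgeEnergy_smul (S : Finset (Fin n)) (c : ℝ) (x : Fin n → ℝ) :
    edgeEnergy S (c • x) = c ^ 2 * edgeEnergy S x := by
  rw [edgeEnergy_eq_edgeMax, edgeEnergy_eq_edgeMax, ← edgeMax_mul S _ (fun _ _ => sq_nonneg _)
    (sq_nonneg c)]
  congr 1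
  ext i j
  simp only [Pi.smul_apply, smul_eq_mul]
  ring

end EdgeMax

section Balanced

variable {n : ℕ}

/-- The energy of an embedding of the vertices, regularized by `η`. -/
noncomputable def embEnergy (E : Finset (Finset (Fin n))) (v : Finset (Fin n) → ℝ) (η : ℝ)
    (u : Fin n → EuclideanSpace ℝ (Fin n)) : ℝ :=
  ∑ S ∈ E, v S * edgeMax S (fun i j => ‖u i - u j‖ ^ 2) + η * ∑ i, ‖u i‖ ^ 2

variable {E : Finset (Finset (Fin n))} {v : Finset (Fin n) → ℝ} {η : ℝ}

lemma continuous_embEnergy : Continuous (embEnergy E v η) := by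
  unfold embEnergy
  refine Continuous.add (continuous_finsetSum _ fun S _ => continuous_const.mul
    (continuous_edgeMax S _ fun i j => ?_)) ?_ <;> fun_prop

lemma embEnergy_nonneg (hv : ∀ S ∈ E, 0 ≤ v S) (hη : 0 ≤ η)
    (u : Fin n → EuclideanSpace ℝ (Fin n)) : 0 ≤ embEnergy E v η u :=
  add_nonneg (Finset.sum_nonneg fun S hS => mul_nonneg (hv S hS)
    (edgeMax_nonneg _ _ fun _ _ => sq_nonneg _))
    (mul_nonneg hη (Finset.sum_nonneg fun _ _ => sq_nonneg _))

lemma embEnergy_smul (c : ℝ) (u : Fin n → EuclideanSpace ℝ (Fin n)) :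
    embEnergy E v η (c • u) = c ^ 2 * embEnergy E v η u := by
  have h : ∀ w : EuclideanSpace ℝ (Fin n), ‖c • w‖ ^ 2 = c ^ 2 * ‖w‖ ^ 2 := fun w => by
    rw [norm_smul, mul_pow, norm_eq_abs, sq_abs]
  unfold embEnergy
  simp only [Pi.smul_apply, ← smul_sub, h]
  have h1 : ∑ i, c ^ 2 * ‖u i‖ ^ 2 = c ^ 2 * ∑ i, ‖u i‖ ^ 2 := (Finset.mul_sum _ _ _).symm
  rw [mul_add, h1, mul_left_comm η, Finset.mul_sum E]
  congr 1
  refine Finset.sum_congr rfl fun S _ => ?_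
  rw [edgeMax_mul S (fun i j => ‖u i - u j‖ ^ 2) (fun _ _ => sq_nonneg _) (sq_nonneg c)]
  ring

lemma embEnergy_add_smul_le (hv : ∀ S ∈ E, 0 ≤ v S)
    (u : Fin n → EuclideanSpace ℝ (Fin n)) (y : EuclideanSpace ℝ (Fin n)) {s : ℝ} (hs : 0 ≤ s) :
    embEnergy E v η (fun i => u i + (s * inner ℝ (u i) y) • y) ≤ embEnergy E v η u +
      (2 * s + s ^ 2 * ‖y‖ ^ 2) * (∑ S ∈ E, v S * edgeEnergy S (fun i => inner ℝ (u i) y) +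
        η * ∑ i, inner ℝ (u i) y ^ 2) := by
  have h : ∀ w : EuclideanSpace ℝ (Fin n), ‖w + (s * inner ℝ w y) • y‖ ^ 2 =
      ‖w‖ ^ 2 + (2 * s + s ^ 2 * ‖y‖ ^ 2) * inner ℝ w y ^ 2 := fun w => by
    rw [norm_add_sq_real, inner_smul_right, norm_smul, mul_pow, norm_eq_abs, sq_abs]
    ring
  have hq : 0 ≤ 2 * s + s ^ 2 * ‖y‖ ^ 2 := by positivity
  set σ := 2 * s + s ^ 2 * ‖y‖ ^ 2
  unfold embEnergy
  have h2 : ∀ S ∈ E, v S * edgeMax S (fun i j => ‖u i + (s * inner ℝ (u i) y) • y -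
      (u j + (s * inner ℝ (u j) y) • y)‖ ^ 2) ≤ v S * edgeMax S (fun i j => ‖u i - u j‖ ^ 2) +
      σ * (v S * edgeEnergy S (fun i => inner ℝ (u i) y)) := by
    intro S hS
    rw [mul_left_comm, ← mul_add]
    refine mul_le_mul_of_nonneg_left ?_ (hv S hS)
    refine edgeMax_le _ _ (add_nonneg (edgeMax_nonneg _ _ fun _ _ => sq_nonneg _)
      (mul_nonneg hq (edgeEnergy_nonneg _ _))) fun i hi j hj => ?_
    have e : u i + (s * inner ℝ (u i) y) • y - (u j + (s * inner ℝ (u j) y) • y) =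
        (u i - u j) + (s * inner ℝ (u i - u j) y) • y := by
      rw [inner_sub_left]; module
    rw [e, h]
    have h3 := le_edgeMax (fun i j => ‖u i - u j‖ ^ 2) hi hj
    have h4 := le_edgeMax (fun i j => ((fun i => inner ℝ (u i) y) i -
      (fun i => inner ℝ (u i) y) j : ℝ) ^ 2) hi hj
    rw [← edgeEnergy_eq_edgeMax] at h4
    rw [inner_sub_left]
    simp only at h3 h4
    gcongr
  have h5 := Finset.sum_le_sum h2
  rw [Finset.sum_add_distrib, ← Finset.mul_sum] at h5
  simp only [h]
  rw [Finset.sum_add_distrib, ← Finset.mul_sum]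
  linarith

lemma le_of_sq_le_exp {q F : ℝ} (hq : 0 ≤ q) (hF : 0 ≤ F)
    (h : ∀ s > 0, (1 + s * q) ^ 2 ≤ exp ((2 * s + s ^ 2 * q) * F)) : q ≤ F := by
  have key : ∀ s, 0 < s → s ≤ 1 / ((2 + q) * F + 1) →
      2 * q ≤ 2 * F + s * (q * F + (2 + q) ^ 2 * F ^ 2) := by
    intro s hs hs1
    have hd : 1 ≤ (2 + q) * F + 1 := by nlinarith [mul_nonneg (by linarith : 0 ≤ 2 + q) hF]
    have hs2 : s ≤ 1 := hs1.trans (by rw [div_le_one (by linarith)]; exact hd)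
    have hs3 : s * ((2 + q) * F) ≤ 1 := by
      rw [le_div_iff₀ (by linarith)] at hs1
      linarith
    set t := (2 * s + s ^ 2 * q) * F with ht
    have ht0 : 0 ≤ t := by positivity
    have ht1 : t ≤ s * ((2 + q) * F) := by
      have : s ^ 2 * q ≤ s * q := by nlinarith [mul_nonneg hs.le hq]
      nlinarith
    have h1 := abs_exp_sub_one_sub_id_le (x := t) (by rw [abs_of_nonneg ht0]; linarith)
    rw [abs_le] at h1
    have h2 := h s hs
    rw [← ht] at h2
    have h3 : t ^ 2 ≤ (s * ((2 + q) * F)) ^ 2 := pow_le_pow_left₀ ht0 ht1 2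
    have h4 : s * (2 * q) ≤ s * (2 * F + s * (q * F + (2 + q) ^ 2 * F ^ 2)) := by
      nlinarith [sq_nonneg (s * q)]
    exact le_of_mul_le_mul_left h4 hs
  set M := q * F + (2 + q) ^ 2 * F ^ 2
  have hM : 0 ≤ M := by positivity
  refine le_of_forall_pos_le_add fun δ hδ => ?_
  have hd : 0 < (2 + q) * F + 1 := by positivity
  have h1 := key (min (1 / ((2 + q) * F + 1)) (δ / (M + 1))) (by positivity) (min_le_left _ _)
  have h2 : min (1 / ((2 + q) * F + 1)) (δ / (M + 1)) * M ≤ δ := by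
    calc _ ≤ δ / (M + 1) * M := by gcongr; exact min_le_right _ _
      _ ≤ δ / (M + 1) * (M + 1) := by gcongr; linarith
      _ = δ := by field_simp
  linarith

lemma det_rank_one_update (u : Fin n → EuclideanSpace ℝ (Fin n)) (y : EuclideanSpace ℝ (Fin n))
    (s : ℝ) : (Matrix.of fun i j => (u i + (s * inner ℝ (u i) y) • y) j).det =
      (Matrix.of fun i j => u i j).det * (1 + s * ‖y‖ ^ 2) := by
  have e : (Matrix.of fun i j => (u i + (s * inner ℝ (u i) y) • y) j) =
      (Matrix.of fun i j => u i j) *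
        (1 + replicateCol Unit (fun i => s * y i) * replicateRow Unit (fun i => y i)) := by
    ext i j
    rw [mul_add, mul_one]
    simp only [of_apply, PiLp.add_apply, PiLp.smul_apply, smul_eq_mul, Matrix.add_apply,
      Matrix.mul_apply,
      replicateCol_apply, replicateRow_apply, Finset.univ_unique, Finset.sum_singleton,
      PiLp.inner_apply, RCLike.inner_apply, conj_trivial]
    congr 1
    rw [Finset.mul_sum, Finset.sum_mul]
    exact Finset.sum_congr rfl fun k _ => by ring
  rw [e, det_mul, det_one_add_replicateCol_mul_replicateRow]
  congr 2
  rw [EuclideanSpace.norm_sq_eq, Finset.mul_sum]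
  simp only [dotProduct, norm_eq_abs, sq_abs]
  exact Finset.sum_congr rfl fun k _ => by ring

/-- An embedding of the vertices of bounded energy such that every `x` is represented by a vector
whose squared norm is at most the (regularized) energy of `x`. -/
theorem exists_balanced_embedding (hn : 0 < n) (hv : ∀ S ∈ E, 0 ≤ v S) (hη : 0 < η) :
    ∃ u : Fin n → EuclideanSpace ℝ (Fin n),
      ∑ S ∈ E, v S * edgeMax S (fun i j => ‖u i - u j‖ ^ 2) ≤ n ∧
      ∀ x : Fin n → ℝ, ∃ y : EuclideanSpace ℝ (Fin n), (∀ i, inner ℝ (u i) y = x i) ∧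
        ‖y‖ ^ 2 ≤ ∑ S ∈ E, v S * edgeEnergy S x + η * ∑ i, x i ^ 2 := by
  have hnR : (0 : ℝ) < n := Nat.cast_pos.2 hn
  set K : Set (Fin n → EuclideanSpace ℝ (Fin n)) := {u | embEnergy E v η u ≤ n} with hK
  have hcl : IsClosed K := isClosed_le continuous_embEnergy continuous_const
  have hbd : K ⊆ Metric.closedBall 0 √(n / η) := by
    intro u hu
    rw [mem_closedBall_zero_iff, pi_norm_le_iff_of_nonneg (sqrt_nonneg _)]
    intro i
    apply le_sqrt_of_sq_le
    rw [le_div_iff₀ hη]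
    have h1 : ‖u i‖ ^ 2 ≤ ∑ i, ‖u i‖ ^ 2 :=
      Finset.single_le_sum (f := fun i => ‖u i‖ ^ 2) (fun _ _ => sq_nonneg _) (mem_univ i)
    have h2 : 0 ≤ ∑ S ∈ E, v S * edgeMax S (fun i j => ‖u i - u j‖ ^ 2) :=
      Finset.sum_nonneg fun S hS => mul_nonneg (hv S hS) (edgeMax_nonneg _ _ fun _ _ => sq_nonneg _)
    have h3 : embEnergy E v η u ≤ n := hu
    unfold embEnergy at h3
    nlinarith
  have hcpt : IsCompact K := (isCompact_closedBall _ _).of_isClosed_subset hcl hbd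
  have hcont : Continuous fun u : Fin n → EuclideanSpace ℝ (Fin n) =>
      |(Matrix.of fun i j => u i j).det| := by
    refine (Continuous.matrix_det ?_).abs
    refine continuous_matrix fun i j => ?_
    simp only [of_apply]
    fun_prop
  obtain ⟨u₀, hu₀, hdet₀⟩ : ∃ u ∈ K, 0 < |(Matrix.of fun i j => u i j).det| := by
    set e : Fin n → EuclideanSpace ℝ (Fin n) := fun i => EuclideanSpace.single i 1
    have he := embEnergy_nonneg hv hη.le e
    set c := √(n / (embEnergy E v η e + 1)) with hc
    have hcpos : 0 < c := sqrt_pos.2 (by positivity)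
    refine ⟨c • e, ?_, ?_⟩
    · change embEnergy E v η (c • e) ≤ n
      rw [embEnergy_smul, hc, sq_sqrt (by positivity), div_mul_eq_mul_div,
        div_le_iff₀ (by positivity)]
      nlinarith
    · have : (Matrix.of fun i j => (c • e) i j) = c • (1 : Matrix (Fin n) (Fin n) ℝ) := by
        ext i j
        simp [e, Matrix.one_apply, eq_comm]
      rw [this, det_smul, det_one, mul_one, abs_pos]
      positivity
  obtain ⟨u, huK, hmax⟩ := hcpt.exists_isMaxOn ⟨u₀, hu₀⟩ hcont.continuousOn
  have hmax' : ∀ w ∈ K, |(Matrix.of fun i j => w i j).det| ≤ |(Matrix.of fun i j => u i j).det| :=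
    fun w hw => hmax hw
  have hdet : 0 < |(Matrix.of fun i j => u i j).det| := hdet₀.trans_le (hmax' _ hu₀)
  have huE : embEnergy E v η u ≤ n := huK
  refine ⟨u, ?_, fun x => ?_⟩
  · have : 0 ≤ η * ∑ i, ‖u i‖ ^ 2 := mul_nonneg hη.le (Finset.sum_nonneg fun _ _ => sq_nonneg _)
    unfold embEnergy at huE
    linarith
  · set B : Matrix (Fin n) (Fin n) ℝ := Matrix.of fun i j => u i j with hB
    have hunit : IsUnit B.det := (abs_pos.1 hdet).isUnit
    set y : EuclideanSpace ℝ (Fin n) := WithLp.toLp 2 (B⁻¹ *ᵥ x) with hy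
    have hyx : ∀ i, inner ℝ (u i) y = x i := by
      intro i
      have : (B *ᵥ (B⁻¹ *ᵥ x)) i = x i := by
        rw [mulVec_mulVec, mul_nonsing_inv _ hunit, one_mulVec]
      rw [← this]
      simp only [PiLp.inner_apply, RCLike.inner_apply, conj_trivial, mulVec, dotProduct, hB,
        of_apply, hy]
      exact Finset.sum_congr rfl fun k _ => mul_comm _ _
    refine ⟨y, hyx, ?_⟩
    set F := ∑ S ∈ E, v S * edgeEnergy S x + η * ∑ i, x i ^ 2 with hF
    have hF0 : 0 ≤ F := add_nonneg (Finset.sum_nonneg fun S hS => mul_nonneg (hv S hS)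
      (edgeEnergy_nonneg _ _)) (mul_nonneg hη.le (Finset.sum_nonneg fun _ _ => sq_nonneg _))
    refine le_of_sq_le_exp (sq_nonneg _) hF0 fun s hs => ?_
    set σ := 2 * s + s ^ 2 * ‖y‖ ^ 2 with hσ
    have hσ0 : 0 ≤ σ := by positivity
    set w : Fin n → EuclideanSpace ℝ (Fin n) := fun i => u i + (s * inner ℝ (u i) y) • y with hw
    have h1 := embEnergy_add_smul_le (η := η) hv u y hs.le
    simp only [hyx] at h1
    rw [← hσ, ← hF] at h1
    have h1' : embEnergy E v η w ≤ n * (1 + σ * F / n) := by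
      have e : (n : ℝ) * (1 + σ * F / n) = n + σ * F := by field_simp
      rw [e, hw]
      simp only [hyx]
      linarith
    set l := 1 + σ * F / n with hl
    have hl0 : 0 < l := by positivity
    have hwK : (√l)⁻¹ • w ∈ K := by
      change embEnergy E v η _ ≤ n
      rw [embEnergy_smul, inv_pow, sq_sqrt hl0.le, inv_mul_le_iff₀ hl0]
      linarith
    have h2 := hmax' _ hwK
    have h3 : (Matrix.of fun i j => ((√l)⁻¹ • w) i j) = (√l)⁻¹ • (Matrix.of fun i j => w i j) := by
      ext i j; simp
    rw [h3, det_smul, hw, det_rank_one_update, Fintype.card_fin, abs_mul, abs_mul,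
      abs_of_pos (show (0 : ℝ) < 1 + s * ‖y‖ ^ 2 by positivity),
      abs_of_pos (show (0 : ℝ) < (√l)⁻¹ ^ n by positivity), inv_pow,
      inv_mul_le_iff₀ (by positivity), mul_comm] at h2
    have h4 : 1 + s * ‖y‖ ^ 2 ≤ √l ^ n := le_of_mul_le_mul_right h2 hdet
    have h5 : (1 + s * ‖y‖ ^ 2) ^ 2 ≤ l ^ n := by
      refine (pow_le_pow_left₀ (by positivity) h4 2).trans (le_of_eq ?_)
      rw [← pow_mul, mul_comm, pow_mul, sq_sqrt hl0.le]
    refine h5.trans ?_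
    have h6 : l ≤ exp (σ * F / n) := by rw [hl, add_comm]; exact add_one_le_exp _
    refine (pow_le_pow_left₀ hl0.le h6 n).trans (le_of_eq ?_)
    rw [← Real.exp_nat_mul]
    congr 1
    field_simp

end Balanced

section MaxSeminorm

variable {V : Type} [NormedAddCommGroup V] [InnerProductSpace ℝ V] {P : Type*}

/-- The seminorm `z ↦ max |⟪a p, z⟫|` over `p ∈ s`. -/
noncomputable def maxSeminorm (s : Finset P) (a : P → V) : Seminorm ℝ V :=
  s.sup fun p => (normSeminorm ℝ ℝ).comp (innerₗ V (a p))

lemma abs_inner_le_maxSeminorm {s : Finset P} (a : P → V) {p : P} (hp : p ∈ s) (z : V) :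
    |inner ℝ (a p) z| ≤ maxSeminorm s a z :=
  Seminorm.le_finset_sup_apply (p := fun p => (normSeminorm ℝ ℝ).comp (innerₗ V (a p))) hp

lemma maxSeminorm_le {s : Finset P} (a : P → V) {z : V} {c : ℝ} (hc : 0 ≤ c)
    (h : ∀ p ∈ s, |inner ℝ (a p) z| ≤ c) : maxSeminorm s a z ≤ c :=
  Seminorm.finset_sup_apply_le hc h

lemma exists_maxSeminorm_eq {s : Finset P} (hs : s.Nonempty) (a : P → V) (z : V) :
    ∃ p ∈ s, maxSeminorm s a z = |inner ℝ (a p) z| := by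
  obtain ⟨p, hp, he⟩ := Seminorm.exists_apply_eq_finset_sup
    (fun p => (normSeminorm ℝ ℝ).comp (innerₗ V (a p))) hs z
  exact ⟨p, hp, he⟩

lemma lintegral_maxSeminorm_sq_le [FiniteDimensional ℝ V] [MeasurableSpace V] [BorelSpace V]
    (s : Finset P) (a : P → V) {δ : ℝ} (hδ : 0 < δ) {N : ℝ} (hN : 2 ≤ N) (hs : (s.card : ℝ) ≤ N)
    (ha : ∀ p ∈ s, ‖a p‖ ^ 2 ≤ δ) :
    ∫⁻ z, ENNReal.ofReal (maxSeminorm s a z ^ 2) ∂(gauss V) ≤ ENNReal.ofReal (30 * δ * log N) := by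
  refine lintegral_gauss_max_le s a hδ hN hs ha _ fun z => ?_
  rcases s.eq_empty_or_nonempty with rfl | h
  · left
    simp [maxSeminorm]
  · obtain ⟨p, hp, he⟩ := exists_maxSeminorm_eq h a z
    exact Or.inr ⟨p, hp, by rw [he, sq_abs]⟩

end MaxSeminorm

section Edges

variable {n : ℕ} {E : Finset (Finset (Fin n))} {v : Finset (Fin n) → ℝ}

/-- The seminorm whose square is the energy of the edge `S` of weight `w` in the coordinates given
by the embedding `u`. -/
noncomputable def edgeSeminorm (u : Fin n → EuclideanSpace ℝ (Fin n)) (w : ℝ)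
    (S : Finset (Fin n)) : Seminorm ℝ (EuclideanSpace ℝ (Fin n)) :=
  maxSeminorm (S ×ˢ S) fun p => √w • (u p.1 - u p.2)

lemma edgeSeminorm_sq (u : Fin n → EuclideanSpace ℝ (Fin n)) {w : ℝ} (hw : 0 ≤ w)
    (S : Finset (Fin n)) (y : EuclideanSpace ℝ (Fin n)) :
    edgeSeminorm u w S y ^ 2 = w * edgeEnergy S fun i => inner ℝ (u i) y := by
  have key : ∀ i j, inner ℝ (√w • (u i - u j)) y ^ 2 =
      w * (inner ℝ (u i) y - inner ℝ (u j) y) ^ 2 :=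
    fun i j => by rw [real_inner_smul_left, mul_pow, sq_sqrt hw, inner_sub_left]
  rcases S.eq_empty_or_nonempty with rfl | hS
  · simp [edgeSeminorm, maxSeminorm, edgeEnergy]
  rw [edgeEnergy_eq_edgeMax]
  apply le_antisymm
  · obtain ⟨p, hp, he⟩ := exists_maxSeminorm_eq (hS.product hS)
      (fun p : Fin n × Fin n => √w • (u p.1 - u p.2)) y
    rw [mem_product] at hp
    rw [edgeSeminorm, he, sq_abs, key]
    exact mul_le_mul_of_nonneg_left
      (le_edgeMax (fun i j => (inner ℝ (u i) y - inner ℝ (u j) y) ^ 2) hp.1 hp.2) hw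
  · obtain ⟨i, hi, j, hj, h⟩ :=
      exists_edgeMax_eq hS fun i j => (inner ℝ (u i) y - inner ℝ (u j) y : ℝ) ^ 2
    rw [h, ← key, ← sq_abs]
    exact pow_le_pow_left₀ (abs_nonneg _) (abs_inner_le_maxSeminorm
      (fun p : Fin n × Fin n => √w • (u p.1 - u p.2)) (mk_mem_product hi hj) y) 2

/-- The edges of `L`, seen as seminorms on the space of an embedding in which they are short. -/
noncomputable def edgeFamily (L : Finset (Finset (Fin n))) (v : Finset (Fin n) → ℝ)
    (hv : ∀ S ∈ L, 0 ≤ v S) (hn : 2 ≤ n) {r : ℕ} (hr : 2 ≤ r) (hL : ∀ S ∈ L, S.card ≤ r)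
    (u : Fin n → EuclideanSpace ℝ (Fin n)) {δ : ℝ} (hδ : 0 < δ)
    (hu : ∀ S ∈ L, v S * edgeMax S (fun i j => ‖u i - u j‖ ^ 2) ≤ δ) :
    GaussFamily (EuclideanSpace ℝ (Fin n)) {S // S ∈ L} where
  N S := edgeSeminorm u (v S) S
  Ninf := maxSeminorm univ fun p : Fin n × Fin n => (√δ * ‖u p.1 - u p.2‖⁻¹) • (u p.1 - u p.2)
  a := 30 * δ * log ((r : ℝ) ^ 2)
  b := 30 * δ * log ((n : ℝ) ^ 2)
  a_pos := by
    have : (2 : ℝ) ≤ r := by exact_mod_cast hr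
    have := log_pos (show (1 : ℝ) < (r : ℝ) ^ 2 by nlinarith)
    positivity
  b_pos := by
    have : (2 : ℝ) ≤ n := by exact_mod_cast hn
    have := log_pos (show (1 : ℝ) < (n : ℝ) ^ 2 by nlinarith)
    positivity
  le_inf S z := by
    refine maxSeminorm_le _ (apply_nonneg _ _) fun p hp => ?_
    refine le_trans ?_ (abs_inner_le_maxSeminorm _ (mem_univ p) z)
    rw [real_inner_smul_left, real_inner_smul_left, abs_mul, abs_mul]
    rw [mem_product] at hp
    rcases eq_or_ne (u p.1 - u p.2) 0 with h0 | h0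
    · simp [h0]
    · refine mul_le_mul_of_nonneg_right ?_ (abs_nonneg _)
      have hpos : 0 < ‖u p.1 - u p.2‖ := norm_pos_iff.2 h0
      rw [abs_of_nonneg (sqrt_nonneg _), abs_of_nonneg (by positivity), ← div_eq_mul_inv,
        le_div_iff₀ hpos]
      apply le_sqrt_of_sq_le
      rw [mul_pow, sq_sqrt (hv S S.2)]
      exact (mul_le_mul_of_nonneg_left (le_edgeMax (fun i j => ‖u i - u j‖ ^ 2) hp.1 hp.2)
        (hv S S.2)).trans (hu S S.2)
  inf_le z := by
    refine maxSeminorm_le _ (by positivity) fun p _ => (abs_real_inner_le_norm _ _).trans ?_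
    refine mul_le_mul_of_nonneg_right ?_ (norm_nonneg z)
    rw [norm_smul, norm_mul, norm_inv, norm_norm, norm_of_nonneg (sqrt_nonneg δ), mul_assoc]
    have h1 : ‖u p.1 - u p.2‖⁻¹ * ‖u p.1 - u p.2‖ ≤ 1 := inv_mul_le_one
    refine (mul_le_of_le_one_right (sqrt_nonneg _) h1).trans (sqrt_le_sqrt ?_)
    have h2 := log_two_le_of_two_le hn
    rw [log_pow]
    push_cast
    nlinarith
  int_le S := by
    have h2 : (2 : ℝ) ≤ r := by exact_mod_cast hr
    refine lintegral_maxSeminorm_sq_le _ _ hδ (by nlinarith) ?_ fun p hp => ?_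
    · rw [card_product, sq, Nat.cast_mul]
      have : ((S : Finset (Fin n)).card : ℝ) ≤ r := by exact_mod_cast hL S S.2
      gcongr
    · rw [mem_product] at hp
      rw [norm_smul, mul_pow, norm_eq_abs, sq_abs, sq_sqrt (hv S S.2)]
      exact (mul_le_mul_of_nonneg_left (le_edgeMax (fun i j => ‖u i - u j‖ ^ 2) hp.1 hp.2)
        (hv S S.2)).trans (hu S S.2)
  int_inf_le := by
    have h2 : (2 : ℝ) ≤ n := by exact_mod_cast hn
    refine lintegral_maxSeminorm_sq_le _ _ hδ (by nlinarith) ?_ fun p _ => ?_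
    · simp [sq]
    · rw [norm_smul, norm_mul, norm_inv, norm_norm, norm_of_nonneg (sqrt_nonneg δ), mul_assoc,
        mul_pow, sq_sqrt hδ.le]
      have h1 : ‖u p.1 - u p.2‖⁻¹ * ‖u p.1 - u p.2‖ ≤ 1 := inv_mul_le_one
      exact mul_le_of_le_one_right hδ.le (pow_le_one₀ (by positivity) h1)
  two_le := by simpa using hn

end Edges

section Halving

variable {n r : ℕ} {E : Finset (Finset (Fin n))} {v : Finset (Fin n) → ℝ}

/-- The energy of the hypergraph with edge set `E` and weights `v`. -/
noncomputable def energy (E : Finset (Finset (Fin n))) (v : Finset (Fin n) → ℝ)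
    (x : Fin n → ℝ) : ℝ := ∑ S ∈ E, v S * edgeEnergy S x

lemma energy_smul (c : ℝ) (x : Fin n → ℝ) : energy E v (c • x) = c ^ 2 * energy E v x := by
  unfold energy
  rw [Finset.mul_sum]
  exact Finset.sum_congr rfl fun S _ => by rw [edgeEnergy_smul]; ring

lemma energy_nonneg (hv : ∀ S ∈ E, 0 ≤ v S) (x : Fin n → ℝ) : 0 ≤ energy E v x :=
  Finset.sum_nonneg fun S hS => mul_nonneg (hv S hS) (edgeEnergy_nonneg S x)

lemma energy_mono {A : Finset (Finset (Fin n))} (hv : ∀ S ∈ E, 0 ≤ v S) (hA : A ⊆ E)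
    (x : Fin n → ℝ) : energy A v x ≤ energy E v x :=
  Finset.sum_le_sum_of_subset_of_nonneg hA fun S hS _ =>
    mul_nonneg (hv S hS) (edgeEnergy_nonneg S x)

lemma exists_light_split_regularized (hn : 2 ≤ n) (hr : 2 ≤ r) (hE : ∀ S ∈ E, S.card ≤ r)
    (hv : ∀ S ∈ E, 0 ≤ v S) (hm : 0 < E.card) {η : ℝ} (hη : 0 < η) :
    ∃ L ⊆ E, ∃ A ⊆ L, 4 * (E \ L).card ≤ E.card ∧ ∀ x, energy E v x ≤ 1 → η * ∑ i, x i ^ 2 ≤ 1 →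
      |energy A v x - energy (L \ A) v x| ≤ 2 ^ 37 * √(n * log n * log r / E.card) := by
  have hmR : (0 : ℝ) < E.card := Nat.cast_pos.2 hm
  have hnR : (2 : ℝ) ≤ n := by exact_mod_cast hn
  have hlogn := log_two_le_of_two_le hn
  have hlogr := log_two_le_of_two_le hr
  obtain ⟨u, hu, hrep⟩ := exists_balanced_embedding (by omega) hv hη
  set d : Finset (Fin n) → ℝ := fun S => v S * edgeMax S (fun i j => ‖u i - u j‖ ^ 2) with hd
  have hd0 : ∀ S ∈ E, 0 ≤ d S := fun S hS =>
    mul_nonneg (hv S hS) (edgeMax_nonneg _ _ fun _ _ => sq_nonneg _)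
  set δ : ℝ := 4 * n / E.card with hδ
  have hδ0 : 0 < δ := by positivity
  set L := E.filter fun S => d S ≤ δ with hL
  have hLE : L ⊆ E := filter_subset _ _
  have hLr : ∀ S ∈ L, S.card ≤ r := fun S hS => hE S (hLE hS)
  have hLv : ∀ S ∈ L, 0 ≤ v S := fun S hS => hv S (hLE hS)
  have hLd : ∀ S ∈ L, d S ≤ δ := fun S hS => (mem_filter.1 hS).2
  set F := edgeFamily L v hLv hn hr hLr u hδ0 hLd with hF
  obtain ⟨e, he⟩ := F.exists_signs_body
  set A := L.filter fun S => ∃ h : S ∈ L, boolSign (e ⟨S, h⟩) = 1 with hA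
  refine ⟨L, hLE, A, filter_subset _ _, ?_, fun x hx hηx => ?_⟩
  · have h1 : ∑ S ∈ E \ L, δ ≤ ∑ S ∈ E \ L, d S := Finset.sum_le_sum fun S hS => by
      rw [hL, mem_sdiff, mem_filter, not_and, not_le] at hS
      exact (hS.2 hS.1).le
    have h2 : ∑ S ∈ E \ L, d S ≤ ∑ S ∈ E, d S :=
      Finset.sum_le_sum_of_subset_of_nonneg sdiff_subset fun S hS _ => hd0 S hS
    have h3 := h1.trans (h2.trans hu)
    rw [Finset.sum_const, nsmul_eq_mul, hδ, mul_div_assoc', div_le_iff₀ hmR] at h3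
    have h4 : (4 * (E \ L).card : ℝ) ≤ E.card := by
      have : (0 : ℝ) < n := by linarith
      refine le_of_mul_le_mul_left ?_ this
      linarith
    exact_mod_cast h4
  · obtain ⟨y, hy, hyn⟩ := hrep x
    change ‖y‖ ^ 2 ≤ energy E v x + _ at hyn
    have hN : ∀ S : {S // S ∈ L}, F.N S ((√2)⁻¹ • y) ^ 2 = 1 / 2 * (v S * edgeEnergy S x) := by
      intro S
      change edgeSeminorm u (v S) S _ ^ 2 = _
      rw [map_smul_eq_mul, mul_pow, edgeSeminorm_sq u (hLv S S.2)]
      simp only [hy, norm_eq_abs, sq_abs, inv_pow]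
      rw [sq_sqrt (by norm_num)]
      ring
    have hbody : (√2)⁻¹ • y ∈ F.body := by
      constructor
      · rw [← sq_le_one_iff₀ (norm_nonneg _), norm_smul, mul_pow, norm_eq_abs, sq_abs, inv_pow,
          sq_sqrt (by norm_num)]
        linarith
      · simp only [hN]
        rw [← Finset.mul_sum, Finset.sum_coe_sort L fun S => v S * edgeEnergy S x]
        have := energy_mono hv hLE x
        unfold energy at this hx
        linarith
    have h1 := he _ hbody
    simp only [hN] at h1
    have h2 : ∑ k : {S // S ∈ L}, boolSign (e k) * (1 / 2 * (v k * edgeEnergy k x)) =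
        1 / 2 * (energy A v x - energy (L \ A) v x) := by
      rw [hA, ← Finset.filter_not]
      unfold energy
      rw [Finset.sum_filter (s := L), Finset.sum_filter (s := L), ← Finset.sum_sub_distrib,
        Finset.mul_sum, ← Finset.sum_coe_sort L]
      refine Finset.sum_congr rfl fun S _ => ?_
      rcases boolSign_cases (e S) with h | h
      · have : ∃ h : (S : Finset (Fin n)) ∈ L, boolSign (e ⟨S, h⟩) = 1 := ⟨S.2, h⟩
        rw [if_pos this, if_neg (not_not.2 this), h]
        ring
      · have : ¬ ∃ h : (S : Finset (Fin n)) ∈ L, boolSign (e ⟨S, h⟩) = 1 := by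
          rintro ⟨h', h1⟩
          change boolSign (e S) = 1 at h1
          linarith
        rw [if_neg this, if_pos this, h]
        ring
    rw [h2, abs_mul, abs_of_pos (by norm_num : (0 : ℝ) < 1 / 2)] at h1
    have hfr : Module.finrank ℝ (EuclideanSpace ℝ (Fin n)) = n := by simp
    rw [hfr] at h1
    set K := (n : ℝ) * log n * log r / E.card with hK
    have hK0 : 0 ≤ K := by positivity
    have e1 : F.a * log n = 240 * K := by
      change 30 * δ * log ((r : ℝ) ^ 2) * log n = _
      rw [log_pow, hδ, hK]
      push_cast
      ring
    have e2 : F.b ≤ 360 * K := by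
      change 30 * δ * log ((n : ℝ) ^ 2) ≤ _
      rw [log_pow, hδ, hK]
      push_cast
      have : 0 ≤ n * log n / E.card := by positivity
      calc (30 : ℝ) * (4 * n / E.card) * (2 * log n) = 240 * (n * log n / E.card) := by ring
        _ ≤ 360 * (n * log n / E.card * log r) := by nlinarith
        _ = _ := by ring
    have e3 : √(F.a * log n) ≤ 16 * √K := by
      rw [e1, sqrt_mul (by norm_num)]
      gcongr
      rw [sqrt_le_left (by norm_num)]; norm_num
    have e4 : √F.b ≤ 20 * √K := by
      refine (sqrt_le_sqrt e2).trans ?_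
      rw [sqrt_mul (by norm_num)]
      gcongr
      rw [sqrt_le_left (by norm_num)]; norm_num
    have : 0 ≤ √K := sqrt_nonneg _
    nlinarith

lemma exists_light_split (hn : 2 ≤ n) (hr : 2 ≤ r) (hE : ∀ S ∈ E, S.card ≤ r)
    (hv : ∀ S ∈ E, 0 ≤ v S) (hm : 0 < E.card) :
    ∃ L ⊆ E, ∃ A ⊆ L, 4 * (E \ L).card ≤ E.card ∧ ∀ x,
      |energy A v x - energy (L \ A) v x| ≤
        2 ^ 37 * √(n * log n * log r / E.card) * energy E v x := by
  set D := 2 ^ 37 * √(n * log n * log r / E.card) with hD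
  have hD0 : 0 ≤ D := by positivity
  obtain ⟨L, hL, A, hA, hc, h⟩ : ∃ L ⊆ E, ∃ A ⊆ L, 4 * (E \ L).card ≤ E.card ∧
      ∀ x, energy E v x ≤ 1 → |energy A v x - energy (L \ A) v x| ≤ D := by
    by_contra! hcon
    choose! x hx using hcon
    set c : Finset (Finset (Fin n)) × Finset (Finset (Fin n)) → ℝ :=
      fun p => ∑ i, x p.1 p.2 i ^ 2 with hc
    have hc0 : ∀ p, 0 ≤ c p := fun p => Finset.sum_nonneg fun _ _ => sq_nonneg _
    have hC0 : 0 ≤ ∑ p, c p := Finset.sum_nonneg fun p _ => hc0 p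
    obtain ⟨L, hL, A, hA, hcard, h⟩ := exists_light_split_regularized hn hr hE hv hm
      (show 0 < 1 / (∑ p, c p + 1) by positivity)
    obtain ⟨h1, h2⟩ := hx L hL A hA hcard
    refine absurd (h _ h1 ?_) (not_le.2 h2)
    have h3 : c (L, A) ≤ ∑ p, c p := Finset.single_le_sum (fun p _ => hc0 p) (mem_univ _)
    change _ * c (L, A) ≤ 1
    rw [one_div, inv_mul_le_iff₀ (by positivity)]
    linarith
  refine ⟨L, hL, A, hA, hc, fun x => ?_⟩
  have h0 := energy_nonneg hv x
  rcases h0.eq_or_lt with h0 | h0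
  · have h1 := energy_mono hv (hA.trans hL) x
    have h2 := energy_mono hv ((sdiff_subset (s := L) (t := A)).trans hL) x
    have h3 := energy_nonneg (fun S hS => hv S (hL (hA hS))) x
    have h4 := energy_nonneg (fun S hS => hv S (hL (sdiff_subset (s := L) (t := A) hS))) x
    rw [← h0] at h1 h2 ⊢
    rw [le_antisymm h1 h3, le_antisymm h2 h4]
    simp
  · have hs : (√(energy E v x))⁻¹ ^ 2 = (energy E v x)⁻¹ := by rw [inv_pow, sq_sqrt h0.le]
    have h1 := h ((√(energy E v x))⁻¹ • x) (by
      rw [energy_smul, hs, inv_mul_cancel₀ h0.ne'])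
    rw [energy_smul, energy_smul, hs, ← mul_sub, abs_mul, abs_of_pos (inv_pos.2 h0),
      inv_mul_le_iff₀ h0] at h1
    linarith

/-- A constant fraction of the edges can be removed at the cost of a small relative error. -/
theorem exists_halving (hn : 2 ≤ n) (hr : 2 ≤ r) (hE : ∀ S ∈ E, S.card ≤ r)
    (hv : ∀ S ∈ E, 0 ≤ v S) (hm : 0 < E.card) :
    ∃ E' ⊆ E, 8 * E'.card ≤ 5 * E.card ∧ ∃ v' : Finset (Fin n) → ℝ, (∀ S ∈ E', 0 ≤ v' S) ∧
      ∀ x, |energy E' v' x - energy E v x| ≤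
        2 ^ 37 * √(n * log n * log r / E.card) * energy E v x := by
  obtain ⟨L, hL, A₀, hA₀, hc, h₀⟩ := exists_light_split hn hr hE hv hm
  obtain ⟨A, hA, hAc, h⟩ : ∃ A ⊆ L, 2 * A.card ≤ L.card ∧ ∀ x,
      |energy A v x - energy (L \ A) v x| ≤
        2 ^ 37 * √(n * log n * log r / E.card) * energy E v x := by
    have hcard := card_sdiff_add_card_eq_card hA₀
    rcases le_total A₀.card (L \ A₀).card with hle | hle
    · exact ⟨A₀, hA₀, by omega, h₀⟩
    · refine ⟨L \ A₀, sdiff_subset, by omega, fun x => ?_⟩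
      rw [Finset.sdiff_sdiff_eq_self hA₀, abs_sub_comm]
      exact h₀ x
  have hcard := card_sdiff_add_card_eq_card hL
  have hdisj : Disjoint (E \ L) A := disjoint_of_subset_right hA sdiff_disjoint
  refine ⟨(E \ L) ∪ A, union_subset sdiff_subset (hA.trans hL), ?_,
    fun S => if S ∈ A then 2 * v S else v S, fun S hS => ?_, fun x => ?_⟩
  · rw [card_union_of_disjoint hdisj]
    omega
  · have hSE : S ∈ E := (union_subset sdiff_subset (hA.trans hL)) hS
    have := hv S hSE
    dsimp only
    split_ifs <;> positivity
  · have e1 : energy ((E \ L) ∪ A) (fun S => if S ∈ A then 2 * v S else v S) x =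
        energy (E \ L) v x + 2 * energy A v x := by
      unfold energy
      rw [Finset.sum_union hdisj, Finset.mul_sum]
      congr 1
      · refine Finset.sum_congr rfl fun S hS => ?_
        dsimp only
        rw [if_neg (Finset.disjoint_left.1 hdisj hS)]
      · refine Finset.sum_congr rfl fun S hS => ?_
        dsimp only
        rw [if_pos hS]
        ring
    have e2 : energy E v x = energy (E \ L) v x + energy L v x := (Finset.sum_sdiff hL).symm
    have e3 : energy L v x = energy (L \ A) v x + energy A v x := (Finset.sum_sdiff hA).symm
    have e4 : energy ((E \ L) ∪ A) (fun S => if S ∈ A then 2 * v S else v S) x - energy E v x =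
        energy A v x - energy (L \ A) v x := by
      rw [e1, e2, e3]; ring
    rw [e4]
    exact h x

end Halving

section Iteration

variable {n r : ℕ}

/-- The logarithmic error of repeatedly halving a set of `m` edges down to `M` edges. -/
noncomputable def iterError (K M : ℝ) (m : ℕ) : ℝ :=
  if (m : ℝ) ≤ M then 0 else 2 ^ 40 * (2 * √(K / M) - √(K / m))

lemma iterError_le {K M : ℝ} (m : ℕ) : iterError K M m ≤ 2 ^ 41 * √(K / M) := by
  unfold iterError
  have h1 : 0 ≤ √(K / M) := sqrt_nonneg _
  have h2 : 0 ≤ √(K / m) := sqrt_nonneg _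
  split_ifs
  · positivity
  · linarith

lemma iterError_step {K M : ℝ} (hK : 0 ≤ K) (hM : 0 < M) {m m' : ℕ} (hm : M < m)
    (hm' : 8 * m' ≤ 5 * m) :
    iterError K M m' + 2 * (2 ^ 37 * √(K / m)) ≤ iterError K M m := by
  have hmm : (8 * m' : ℝ) ≤ 5 * m := by exact_mod_cast hm'
  have h0 : 0 ≤ √(K / m) := sqrt_nonneg _
  unfold iterError
  rw [if_neg (not_le.2 hm)]
  split_ifs with h
  · have : √(K / m) ≤ √(K / M) := by gcongr
    linarith
  · push Not at h
    have hpos : (0 : ℝ) < m' := hM.trans h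
    have h1 : 5 / 4 * √(K / m) ≤ √(K / m') := by
      rw [← sqrt_sq (show (0 : ℝ) ≤ 5 / 4 by norm_num), ← sqrt_mul (by norm_num)]
      apply sqrt_le_sqrt
      have hmp : (0 : ℝ) < m := hM.trans hm
      rw [mul_div_assoc', div_le_div_iff₀ hmp hpos]
      nlinarith
    linarith

lemma exists_sparsifier_exp (hn : 2 ≤ n) (hr : 2 ≤ r) {M : ℝ} (hM : 0 < M)
    (hMK : 2 ^ 37 * √(n * log n * log r / M) ≤ 1 / 2) (m : ℕ) :
    ∀ (E : Finset (Finset (Fin n))) (v : Finset (Fin n) → ℝ), E.card = m →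
      (∀ S ∈ E, S.card ≤ r) → (∀ S ∈ E, 0 ≤ v S) →
      ∃ E' ⊆ E, (E'.card : ℝ) ≤ M ∧ ∃ v' : Finset (Fin n) → ℝ, (∀ S ∈ E', 0 ≤ v' S) ∧ ∀ x,
        energy E' v' x ≤ exp (iterError (n * log n * log r) M m) * energy E v x ∧
        energy E v x ≤ exp (iterError (n * log n * log r) M m) * energy E' v' x := by
  have hlogn := log_two_le_of_two_le hn
  have hlogr := log_two_le_of_two_le hr
  set K := (n : ℝ) * log n * log r with hK
  have hK0 : 0 ≤ K := by positivity
  induction m using Nat.strong_induction_on with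
  | _ m ih =>
  intro E v hEm hE hv
  by_cases hmM : (m : ℝ) ≤ M
  · refine ⟨E, subset_rfl, by rwa [hEm], v, hv, fun x => ?_⟩
    rw [iterError, if_pos hmM, Real.exp_zero, one_mul]
    exact ⟨le_rfl, le_rfl⟩
  · push Not at hmM
    have hm0 : 0 < m := by exact_mod_cast hM.trans hmM
    obtain ⟨E₁, hE₁, hc, v₁, hv₁, h₁⟩ := exists_halving hn hr hE hv (hEm ▸ hm0)
    rw [hEm] at hc h₁
    obtain ⟨E', hE', hc', v', hv', h'⟩ := ih E₁.card (by omega) E₁ v₁ rfl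
      (fun S hS => hE S (hE₁ hS)) hv₁
    refine ⟨E', hE'.trans hE₁, hc', v', hv', fun x => ?_⟩
    have hstep := iterError_step hK0 hM hmM hc
    obtain ⟨a1, a2⟩ := h' x
    have a3 := h₁ x
    rw [← hK] at a3
    have hη0 : 0 ≤ 2 ^ 37 * √(K / m) := by positivity
    have hη1 : 2 ^ 37 * √(K / m) ≤ 1 / 2 := by
      refine le_trans ?_ hMK
      gcongr
    set η := 2 ^ 37 * √(K / m)
    rw [abs_le] at a3
    have hf := energy_nonneg hv x
    have hf1 := energy_nonneg hv₁ x
    have hf' := energy_nonneg hv' x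
    have hexp : 1 + 2 * η ≤ exp (2 * η) := by linarith [add_one_le_exp (2 * η)]
    have b1 : energy E₁ v₁ x ≤ exp (2 * η) * energy E v x := by
      have : (1 + 2 * η) * energy E v x ≤ exp (2 * η) * energy E v x := by gcongr
      nlinarith
    have b2 : energy E v x ≤ exp (2 * η) * energy E₁ v₁ x := by
      have h2 : (1 + 2 * η) * energy E₁ v₁ x ≤ exp (2 * η) * energy E₁ v₁ x := by gcongr
      have h3 : (1 - η) * energy E v x ≤ energy E₁ v₁ x := by linarith
      have h4 : (1 + 2 * η) * ((1 - η) * energy E v x) ≤ (1 + 2 * η) * energy E₁ v₁ x := by gcongr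
      have h5 : 0 ≤ η * (1 - 2 * η) * energy E v x :=
        mul_nonneg (mul_nonneg hη0 (by linarith)) hf
      nlinarith
    have hmul : exp (iterError K M E₁.card) * exp (2 * η) ≤ exp (iterError K M m) := by
      rw [← Real.exp_add]
      exact exp_le_exp.2 hstep
    have c0 : 0 ≤ exp (iterError K M E₁.card) := (exp_pos _).le
    have c1 : 0 ≤ exp (2 * η) := (exp_pos _).le
    constructor
    · calc _ ≤ exp (iterError K M E₁.card) * (exp (2 * η) * energy E v x) :=
          a1.trans (mul_le_mul_of_nonneg_left b1 c0)
        _ = exp (iterError K M E₁.card) * exp (2 * η) * energy E v x := by ring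
        _ ≤ _ := mul_le_mul_of_nonneg_right hmul hf
    · calc _ ≤ exp (2 * η) * (exp (iterError K M E₁.card) * energy E' v' x) :=
          b2.trans (mul_le_mul_of_nonneg_left a2 c1)
        _ = exp (iterError K M E₁.card) * exp (2 * η) * energy E' v' x := by ring
        _ ≤ _ := mul_le_mul_of_nonneg_right hmul hf'

end Iteration

theorem stmt_0 :
    ∃ C : ℝ, 0 < C ∧
      ∀ (n r : ℕ) (E : Finset (Finset (Fin n))) (v : Finset (Fin n) → ℝ),
        -- every hyperedge `S ∈ E` satisfies `2 ≤ |S| ≤ r` and has weight `v_S ≥ 0`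
        (∀ S ∈ E, 2 ≤ S.card ∧ S.card ≤ r) →
        (∀ S ∈ E, 0 ≤ v S) →
        ∀ ε : ℝ, 0 < ε → ε < 1 →
        ∃ E' ⊆ E, ((E'.card : ℝ) ≤ C * n * ε⁻¹ ^ 2 * Real.log n * Real.log r ∧
          ∃ v' : Finset (Fin n) → ℝ, (∀ S ∈ E', 0 ≤ v' S) ∧
            ∀ x : Fin n → ℝ,
              (1 + ε)⁻¹ * (∑ S ∈ E', v' S * edgeEnergy S x) ≤
                  ∑ S ∈ E, v S * edgeEnergy S x ∧
                ∑ S ∈ E, v S * edgeEnergy S x ≤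
                  (1 + ε) * (∑ S ∈ E', v' S * edgeEnergy S x)) := by
  refine ⟨2 ^ 84, by norm_num, fun n r E v hE hv ε hε hε1 => ?_⟩
  rcases E.eq_empty_or_nonempty with rfl | ⟨S, hS⟩
  · refine ⟨∅, subset_rfl, ?_, v, by simp, fun x => by simp⟩
    have := log_natCast_nonneg n
    have := log_natCast_nonneg r
    rw [card_empty, Nat.cast_zero]
    positivity
  have hr : 2 ≤ r := (hE S hS).1.trans (hE S hS).2
  have hn : 2 ≤ n := (hE S hS).1.trans ((card_le_univ S).trans_eq (Fintype.card_fin n))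
  have hlogn := log_two_le_of_two_le hn
  have hlogr := log_two_le_of_two_le hr
  set K := (n : ℝ) * log n * log r with hK
  have hnR : (0 : ℝ) < n := by exact_mod_cast (by omega : 0 < n)
  have hK0 : 0 < K := by positivity
  set M := 2 ^ 84 * n * ε⁻¹ ^ 2 * log n * log r with hMdef
  have hM : 0 < M := by positivity
  have hsq : √(K / M) = ε / 2 ^ 42 := by
    rw [← sqrt_sq (show 0 ≤ ε / 2 ^ 42 by positivity)]
    congr 1
    rw [hK, hMdef]
    field_simp
  obtain ⟨E', hE', hc, v', hv', h⟩ := exists_sparsifier_exp hn hr hM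
    (by rw [← hK, hsq]; linarith) _ E v rfl (fun S hS => (hE S hS).2) hv
  refine ⟨E', hE', hc, v', hv', fun x => ?_⟩
  obtain ⟨h1, h2⟩ := h x
  have hexp : exp (iterError K M E.card) ≤ 1 + ε := by
    have a1 := iterError_le (K := K) (M := M) E.card
    rw [hsq] at a1
    have a2 : iterError K M E.card ≤ ε / 2 := by linarith
    refine (exp_le_exp.2 a2).trans ?_
    have a3 := abs_exp_sub_one_sub_id_le (x := ε / 2) (by rw [abs_of_pos (by linarith)]; linarith)
    rw [abs_le] at a3
    nlinarith
  rw [inv_mul_le_iff₀ (by linarith)]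
  exact ⟨h1.trans (mul_le_mul_of_nonneg_right hexp (energy_nonneg hv x)),
    h2.trans (mul_le_mul_of_nonneg_right hexp (energy_nonneg hv' x))⟩
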